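/- For m, n ≥ 4 where at least one of m, n is odd, dmg(C_m □ C_n) = max{ dmg(C_m)·|V(C_n)| , dmg(C_n)·|V(C_m)| } = max{ ⌊(m−1)/2⌋·n , ⌊(n−1)/2⌋·m }. -/

import Mathlib

open SimpleGraph

/-!
Formalization of the game of Cops and Robber (one cop, one robber) and the damage number.

Round 0: the cop chooses a starting vertex, then the robber chooses a starting vertex.
In each subsequent round the cop moves to an adjacent vertex or passes, after which the
robber moves to an adjacent vertex or passes.  Strategies are modelled as functions of
the full history of positions (most recent first).
-/

/-- A cop strategy: an initial vertex together with a move function taking the history of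
cop positions (most recent first, nonempty) and of robber positions (most recent first)
to the cop's next position. -/
structure CopStrategy (V : Type*) where
  init : V
  move : List V → List V → V

/-- A robber strategy: an initial vertex chosen in response to the cop's initial vertex,
together with a move function taking the history of cop positions (most recent first,
including the cop's move from the current round) and of robber positions (most recent
first) to the robber's next position. -/
structure RobberStrategy (V : Type*) where
  init : V → V
  move : List V → List V → V

variable {V : Type*}

/-- A cop move function is legal for `G` if from any position it either passes or
moves along an edge of `G`. -/
def LegalCopMove (G : SimpleGraph V) (cs : List V → List V → V) : Prop :=
  ∀ (c : V) (ch rh : List V), cs (c :: ch) rh = c ∨ G.Adj c (cs (c :: ch) rh)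

/-- A robber move function is legal for `G` if from any position it either passes or
moves along an edge of `G`. -/
def LegalRobMove (G : SimpleGraph V) (rs : List V → List V → V) : Prop :=
  ∀ (r : V) (ch rh : List V), rs ch (r :: rh) = r ∨ G.Adj r (rs ch (r :: rh))

/-- A legal cop strategy: every move passes or goes along an edge. -/
def CopStrategy.Legal (G : SimpleGraph V) (CS : CopStrategy V) : Prop :=
  LegalCopMove G CS.move

/-- A legal robber strategy: every move passes or goes along an edge. -/
def RobberStrategy.Legal (G : SimpleGraph V) (RS : RobberStrategy V) : Prop :=
  LegalRobMove G RS.move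

/-- `play CS RS n = (cₙ, rₙ, earlier cop positions, earlier robber positions)`:
the state of the game after round `n`, when the cop plays `CS` and the robber plays `RS`.
In each round the cop moves first, then the robber moves. -/
def play (CS : CopStrategy V) (RS : RobberStrategy V) : ℕ → V × V × List V × List V
  | 0 => (CS.init, RS.init CS.init, [], [])
  | n + 1 =>
    let p := play CS RS n
    let c := CS.move (p.1 :: p.2.2.1) (p.2.1 :: p.2.2.2)
    let r := RS.move (c :: p.1 :: p.2.2.1) (p.2.1 :: p.2.2.2)
    (c, r, p.1 :: p.2.2.1, p.2.1 :: p.2.2.2)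

/-- The cop's position after its move in round `n`. -/
def copPos (CS : CopStrategy V) (RS : RobberStrategy V) (n : ℕ) : V := (play CS RS n).1

/-- The robber's position after its move in round `n`. -/
def robPos (CS : CopStrategy V) (RS : RobberStrategy V) (n : ℕ) : V := (play CS RS n).2.1

/-- The robber damages `v`: at the end of some round `n` the robber occupies `v`, having
never been captured up to that point (neither by moving onto the cop, nor by the cop's
move in any round up to and including round `n + 1`); it then passes or moves in
round `n + 1`, damaging `v`. -/
def Damages (CS : CopStrategy V) (RS : RobberStrategy V) (v : V) : Prop :=
  ∃ n, robPos CS RS n = v ∧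
    ∀ k ≤ n, copPos CS RS k ≠ robPos CS RS k ∧ copPos CS RS (k + 1) ≠ robPos CS RS k

/-- The set of vertices damaged by the robber during the play of `CS` against `RS`. -/
def damageSet (CS : CopStrategy V) (RS : RobberStrategy V) : Set V :=
  {v | Damages CS RS v}

/-- The damage number of `G`: the minimum over legal cop strategies of the maximum over
legal robber strategies of the number of distinct damaged vertices. -/
noncomputable def dmg (G : SimpleGraph V) : ℕ :=
  sInf { n | ∃ CS : CopStrategy V, CS.Legal G ∧
    ∀ RS : RobberStrategy V, RS.Legal G → (damageSet CS RS).ncard ≤ n }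

/-- A cop strategy passes during the first round. -/
def CopStrategy.PassesFirst (CS : CopStrategy V) : Prop :=
  ∀ r : V, CS.move [CS.init] [r] = CS.init

/-- The damage number of `G` when the cop is required to pass during the first round. -/
noncomputable def dmg' (G : SimpleGraph V) : ℕ :=
  sInf { n | ∃ CS : CopStrategy V, CS.Legal G ∧ CS.PassesFirst ∧
    ∀ RS : RobberStrategy V, RS.Legal G → (damageSet CS RS).ncard ≤ n }

/-- The eccentricity of a vertex: the maximum distance from `u` to any vertex. -/
noncomputable def ecc (G : SimpleGraph V) (u : V) : ℕ := sSup (Set.range (G.dist u))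

/-- The radius of a graph: the minimum eccentricity over all vertices. -/
noncomputable def gRadius (G : SimpleGraph V) : ℕ := sInf (Set.range (ecc G))

/-! ### The game framework -/

/-- Closed neighbourhood relation. -/
def Nb (G : SimpleGraph V) (u v : V) : Prop := v = u ∨ G.Adj u v

theorem Nb.rfl' {G : SimpleGraph V} (u : V) : Nb G u u := Or.inl rfl

/-- `Reach G Goal c r S`: from the state in which the cop (having just moved) is at `c`, the robber
is at `r` and the damaged set is `S`, the robber can force a state satisfying `Goal`. -/
inductive Reach (G : SimpleGraph V) (Goal : V → V → Set V → Prop) : V → V → Set V → Prop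
  | done (c r : V) (S : Set V) : Goal c r S → Reach G Goal c r S
  | step (c r : V) (S : Set V) (r' : V) : Nb G r r' → (∀ c', Nb G c c' → c' ≠ r') →
      (∀ c', Nb G c c' → Reach G Goal c' r' (insert r' S)) → Reach G Goal c r S

theorem Reach.bind {G : SimpleGraph V} {Goal Goal' : V → V → Set V → Prop} {c r : V} {S : Set V}
    (h : Reach G Goal c r S) (h' : ∀ c r S, Goal c r S → Reach G Goal' c r S) :
    Reach G Goal' c r S := by
  induction h with
  | done c r S h => exact h' _ _ _ h
  | step c r S r' h1 h2 _ ih => exact Reach.step c r S r' h1 h2 ih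

open Classical in
/-- The oblivious robber strategy following the sequence `ρ`. -/
noncomputable def robOf (G : SimpleGraph V) (ρ : ℕ → V) : RobberStrategy V where
  init := fun _ => ρ 0
  move := fun _ rh => match rh with
    | [] => ρ 0
    | r :: t => if Nb G r (ρ (t.length + 1)) then ρ (t.length + 1) else r

open Classical in
theorem robOf_move (G : SimpleGraph V) (ρ : ℕ → V) (ch t : List V) (r : V) :
    (robOf G ρ).move ch (r :: t) = if Nb G r (ρ (t.length + 1)) then ρ (t.length + 1) else r := rfl

theorem robOf_legal (G : SimpleGraph V) (ρ : ℕ → V) : (robOf G ρ).Legal G := by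
  intro r ch rh
  simp only [robOf]
  split_ifs with h
  · exact h
  · exact Or.inl rfl

theorem play_length (CS : CopStrategy V) (RS : RobberStrategy V) (n : ℕ) :
    (play CS RS n).2.2.2.length = n := by
  induction n with
  | zero => rfl
  | succ n ih => simp [play, ih]

theorem robPos_robOf (G : SimpleGraph V) (CS : CopStrategy V) (ρ : ℕ → V)
    (hρ : ∀ i, Nb G (ρ i) (ρ (i + 1))) (n : ℕ) : robPos CS (robOf G ρ) n = ρ n := by
  induction n with
  | zero => rfl
  | succ n ih =>
    have hl := play_length CS (robOf G ρ) n
    unfold robPos at ih ⊢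
    simp only [play, robOf_move]
    rw [hl, ih, if_pos (hρ n)]

theorem play_robOf_congr (G : SimpleGraph V) (CS : CopStrategy V) (ρ ρ' : ℕ → V) (n : ℕ)
    (h : ∀ i ≤ n, ρ i = ρ' i) : play CS (robOf G ρ) n = play CS (robOf G ρ') n := by
  induction n with
  | zero => simp [play, robOf, h 0 le_rfl]
  | succ n ih =>
    have ih' := ih (fun i hi => h i (by omega))
    have hl := play_length CS (robOf G ρ') n
    simp only [play, ih']
    have : ∀ ch : List V, (robOf G ρ).move ch ((play CS (robOf G ρ') n).2.1 ::
        (play CS (robOf G ρ') n).2.2.2) = (robOf G ρ').move ch ((play CS (robOf G ρ') n).2.1 ::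
        (play CS (robOf G ρ') n).2.2.2) := by
      intro ch
      rw [robOf_move, robOf_move, hl, h (n + 1) le_rfl]
    rw [this]

theorem copPos_succ (CS : CopStrategy V) (RS : RobberStrategy V) (n : ℕ) :
    copPos CS RS (n + 1) = CS.move ((play CS RS n).1 :: (play CS RS n).2.2.1)
      ((play CS RS n).2.1 :: (play CS RS n).2.2.2) := rfl

theorem copPos_nb {G : SimpleGraph V} {CS : CopStrategy V} (h : CS.Legal G)
    (RS : RobberStrategy V) (n : ℕ) : Nb G (copPos CS RS n) (copPos CS RS (n + 1)) := by
  rw [copPos_succ]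
  exact h _ _ _

theorem reach_sound [Finite V] {G : SimpleGraph V} {CS : CopStrategy V} (hCS : CS.Legal G) {K : ℕ}
    {Goal : V → V → Set V → Prop} (hG : ∀ c r S, Goal c r S → K ≤ S.ncard)
    {c r : V} {S : Set V} (h : Reach G Goal c r S) :
    ∀ (ρ : ℕ → V) (n : ℕ), (∀ i, Nb G (ρ i) (ρ (i + 1))) → (∀ i, n ≤ i → ρ i = ρ n) →
      ρ n = r → copPos CS (robOf G ρ) (n + 1) = c → (∀ v ∈ S, ∃ i ≤ n, ρ i = v) →
      (∀ k ≤ n, copPos CS (robOf G ρ) k ≠ ρ k ∧ copPos CS (robOf G ρ) (k + 1) ≠ ρ k) →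
      ∃ RS : RobberStrategy V, RS.Legal G ∧ K ≤ (damageSet CS RS).ncard := by
  induction h with
  | done c r S h =>
    intro ρ n hρ _ _ _ hS hcap
    refine ⟨robOf G ρ, robOf_legal G ρ, (hG c r S h).trans (Set.ncard_le_ncard ?_ (Set.toFinite _))⟩
    intro v hv
    obtain ⟨i, hi, rfl⟩ := hS v hv
    refine ⟨i, robPos_robOf G CS ρ hρ i, fun k hk => ?_⟩
    rw [robPos_robOf G CS ρ hρ k]
    exact hcap k (hk.trans hi)
  | step c r S r' h1 h2 _ ih =>
    intro ρ n hρ hconst hr hc hS hcap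
    let ρ' : ℕ → V := fun i => if i ≤ n then ρ i else r'
    have e1 : ∀ i ≤ n, ρ' i = ρ i := fun i hi => if_pos hi
    have e2 : ∀ i, n < i → ρ' i = r' := fun i hi => if_neg (by omega)
    have hρ' : ∀ i, Nb G (ρ' i) (ρ' (i + 1)) := by
      intro i
      rcases lt_trichotomy i n with hi | hi | hi
      · rw [e1 i hi.le, e1 (i + 1) hi]; exact hρ i
      · rw [e1 i hi.le, e2 (i + 1) (by omega), hi, hr]; exact h1
      · rw [e2 i hi, e2 (i + 1) (by omega)]; exact Nb.rfl' _
    have hcop : ∀ k ≤ n + 1, copPos CS (robOf G ρ') k = copPos CS (robOf G ρ) k := by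
      intro k hk
      cases k with
      | zero => rfl
      | succ k =>
        rw [copPos_succ, copPos_succ,
          play_robOf_congr G CS ρ' ρ k (fun i hi => e1 i (by omega))]
    have hnb := copPos_nb hCS (robOf G ρ') (n + 1)
    rw [hcop _ le_rfl, hc] at hnb
    refine ih _ hnb ρ' (n + 1) hρ' ?_ (e2 _ (by omega)) rfl ?_ ?_
    · intro i hi; rw [e2 _ (by omega), e2 _ (by omega)]
    · intro v hv
      rcases hv with hv | hv
      · exact ⟨n + 1, le_rfl, by rw [e2 _ (by omega), hv]⟩
      · obtain ⟨i, hi, hiv⟩ := hS v hv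
        exact ⟨i, by omega, by rw [e1 i hi, hiv]⟩
    · intro k hk
      rcases Nat.lt_or_ge n k with hk' | hk'
      · obtain rfl : k = n + 1 := by omega
        rw [e2 _ hk', hcop _ le_rfl, hc]
        exact ⟨h2 c (Nb.rfl' c), h2 _ hnb⟩
      · rw [e1 k hk', hcop k (by omega), hcop (k + 1) (by omega)]
        exact hcap k hk'

theorem le_dmg_of_reach [Finite V] [Nonempty V] {G : SimpleGraph V} {K : ℕ}
    {Goal : V → V → Set V → Prop} (hG : ∀ c r S, Goal c r S → K ≤ S.ncard)
    (h : ∀ c0, ∃ r0, ∀ c1, Nb G c0 c1 → c1 ≠ r0 ∧ Reach G Goal c1 r0 {r0}) : K ≤ dmg G := by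
  unfold dmg
  have hne : { n | ∃ CS : CopStrategy V, CS.Legal G ∧
    ∀ RS : RobberStrategy V, RS.Legal G → (damageSet CS RS).ncard ≤ n }.Nonempty := by
    let v0 : V := Classical.arbitrary V
    refine ⟨(Set.univ : Set V).ncard, ⟨v0, fun ch _ => ch.headD v0⟩, ?_, ?_⟩
    · intro c ch rh; left; rfl
    · intro RS _
      exact Set.ncard_le_ncard (Set.subset_univ _) (Set.toFinite _)
  obtain ⟨CS, hCS, hb⟩ := Nat.sInf_mem hne
  obtain ⟨r0, hr0⟩ := h CS.init
  have hnb := copPos_nb hCS (robOf G fun _ => r0) 0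
  have h1 := hr0 _ hnb
  have h0 := hr0 CS.init (Nb.rfl' _)
  obtain ⟨RS, hRS, hK⟩ := reach_sound hCS hG h1.2 (fun _ => r0) 0 (fun _ => Nb.rfl' _)
    (fun _ _ => rfl) rfl rfl (fun v hv => ⟨0, le_rfl, hv.symm⟩) (by
      intro k hk
      obtain rfl : k = 0 := by omega
      exact ⟨h0.1, h1.1⟩)
  exact hK.trans (hb RS hRS)

/-- The stuck principle. -/
theorem stuck [Finite V] {G : SimpleGraph V} {Goal : V → V → Set V → Prop} (A : V → V → Prop)
    {c0 r0 : V} {S0 : Set V} (hA : A c0 r0) (hr : r0 ∈ S0) (hn : ¬ Reach G Goal c0 r0 S0) :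
    ∃ (S : Set V) (P : V → V → Prop), S0 ⊆ S ∧ (∃ c r, P c r) ∧
      (∀ c r, P c r → A c r ∧ r ∈ S ∧ ¬ Reach G Goal c r S) ∧
      (∀ c r r', P c r → Nb G r r' → (∀ c', Nb G c c' → c' ≠ r' ∧ A c' r') →
        ∃ c', Nb G c c' ∧ P c' r') := by
  let F : Set (Set V) := {S | S0 ⊆ S ∧ ∃ c r, A c r ∧ r ∈ S ∧ ¬ Reach G Goal c r S}
  have hF : F.Nonempty := ⟨S0, subset_rfl, c0, r0, hA, hr, hn⟩
  obtain ⟨S, hS⟩ := (Set.toFinite F).exists_maximal hF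
  obtain ⟨⟨hS0, c1, r1, h1⟩, hmax⟩ := hS
  refine ⟨S, fun c r => A c r ∧ r ∈ S ∧ ¬ Reach G Goal c r S, hS0, ⟨c1, r1, h1⟩,
    fun c r h => h, ?_⟩
  rintro c r r' ⟨_, _, h3⟩ hnb hall
  by_contra hcon
  push Not at hcon
  apply h3
  refine Reach.step c r S r' hnb (fun c' h => (hall c' h).1) (fun c' h => ?_)
  by_contra hnr
  have hmem : insert r' S ∈ F :=
    ⟨hS0.trans (Set.subset_insert _ _), c', r', (hall c' h).2, Set.mem_insert _ _, hnr⟩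
  have := hmax hmem (Set.subset_insert _ _)
  have hr' : r' ∈ S := this (Set.mem_insert _ _)
  rw [Set.insert_eq_of_mem hr'] at hnr
  exact hnr (hcon c' h (hall c' h).2 hr')

/-! ### Upper bounds via cop automata -/

open Classical in
/-- The automaton computing the next cop position and a damage bound from the robber history. -/
noncomputable def autoF (G : SimpleGraph V) (Inv : V → V → Set V → Prop) (c0 : V) :
    List V → V × Set V
  | [] => (c0, ∅)
  | [r0] => if h : ∃ p : V × Set V, Nb G c0 p.1 ∧ (p.1 = r0 ∨ r0 ∈ p.2 ∧ Inv p.1 r0 p.2)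
      then h.choose else (c0, ∅)
  | r' :: r :: t =>
      let q := autoF G Inv c0 (r :: t)
      if h : ∃ p : V × Set V, Nb G q.1 p.1 ∧
          (p.1 = r' ∨ q.2 ⊆ p.2 ∧ r' ∈ p.2 ∧ Inv p.1 r' p.2)
        then h.choose else q

open Classical in
/-- The cop strategy following the automaton. -/
noncomputable def autoCop (G : SimpleGraph V) (Inv : V → V → Set V → Prop) (c0 : V) :
    CopStrategy V where
  init := c0
  move := fun ch rh => if Nb G (ch.headD c0) (autoF G Inv c0 rh).1 then (autoF G Inv c0 rh).1
    else ch.headD c0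

open Classical in
theorem autoCop_move (G : SimpleGraph V) (Inv : V → V → Set V → Prop) (c0 c : V)
    (ch rh : List V) : (autoCop G Inv c0).move (c :: ch) rh =
    if Nb G c (autoF G Inv c0 rh).1 then (autoF G Inv c0 rh).1 else c := rfl

theorem autoCop_legal (G : SimpleGraph V) (Inv : V → V → Set V → Prop) (c0 : V) :
    (autoCop G Inv c0).Legal G := by
  intro c ch rh
  rw [autoCop_move]
  split_ifs with h
  · exact h
  · exact Or.inl rfl

theorem cop_bound [Finite V] {G : SimpleGraph V} (Inv : V → V → Set V → Prop) (c0 : V) (k : ℕ)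
    (init : ∀ r0, r0 ≠ c0 → ∃ c1, Nb G c0 c1 ∧ (c1 = r0 ∨ ∃ D : Set V, r0 ∈ D ∧ Inv c1 r0 D))
    (step : ∀ c r D r', Inv c r D → Nb G r r' → ∃ c', Nb G c c' ∧
      (c' = r' ∨ ∃ D' : Set V, D ⊆ D' ∧ r' ∈ D' ∧ Inv c' r' D'))
    (bd : ∀ c r D, Inv c r D → D.ncard ≤ k) : dmg G ≤ k := by
  unfold dmg
  refine Nat.sInf_le ⟨autoCop G Inv c0, autoCop_legal G Inv c0, fun RS hRS => ?_⟩
  set CS := autoCop G Inv c0 with hCS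
  have main : ∀ n, (∀ j ≤ n, copPos CS RS j ≠ robPos CS RS j ∧
      copPos CS RS (j + 1) ≠ robPos CS RS j) →
      let q := autoF G Inv c0 (robPos CS RS n :: (play CS RS n).2.2.2)
      q.1 = copPos CS RS (n + 1) ∧ Inv q.1 (robPos CS RS n) q.2 ∧
        ∀ j ≤ n, robPos CS RS j ∈ q.2 := by
    intro n
    induction n with
    | zero =>
      intro hcap q
      have h0 := hcap 0 le_rfl
      have hex : ∃ p : V × Set V, Nb G c0 p.1 ∧
          (p.1 = robPos CS RS 0 ∨ robPos CS RS 0 ∈ p.2 ∧ Inv p.1 (robPos CS RS 0) p.2) := by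
        obtain ⟨c1, h1, h2 | ⟨D, h2, h3⟩⟩ := init (robPos CS RS 0) (fun h => h0.1 h.symm)
        · exact ⟨(c1, ∅), h1, Or.inl h2⟩
        · exact ⟨(c1, D), h1, Or.inr ⟨h2, h3⟩⟩
      have hq : q = hex.choose := by
        change autoF G Inv c0 [robPos CS RS 0] = _
        rw [autoF, dif_pos hex]
      have hs := hex.choose_spec
      rw [← hq] at hs
      have hc : q.1 = copPos CS RS 1 := by
        rw [copPos_succ]
        change q.1 = (autoCop G Inv c0).move (c0 :: _) (robPos CS RS 0 :: (play CS RS 0).2.2.2)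
        rw [autoCop_move, if_pos hs.1]
      rcases hs.2 with h | h
      · exact absurd (hc ▸ h) h0.2
      · refine ⟨hc, h.2, fun j hj => ?_⟩
        obtain rfl : j = 0 := by omega
        exact h.1
    | succ n ih =>
      intro hcap q
      obtain ⟨i1, i2, i3⟩ := ih (fun j hj => hcap j (by omega))
      set q0 := autoF G Inv c0 (robPos CS RS n :: (play CS RS n).2.2.2) with hq0
      have hnb : Nb G (robPos CS RS n) (robPos CS RS (n + 1)) := hRS _ _ _
      have hex : ∃ p : V × Set V, Nb G q0.1 p.1 ∧ (p.1 = robPos CS RS (n + 1) ∨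
          q0.2 ⊆ p.2 ∧ robPos CS RS (n + 1) ∈ p.2 ∧ Inv p.1 (robPos CS RS (n + 1)) p.2) := by
        obtain ⟨c', h1, h2 | ⟨D, h2, h3⟩⟩ := step _ _ _ _ i2 hnb
        · exact ⟨(c', ∅), h1, Or.inl h2⟩
        · exact ⟨(c', D), h1, Or.inr ⟨h2, h3⟩⟩
      have hq : q = hex.choose := by
        change autoF G Inv c0 (robPos CS RS (n + 1) :: robPos CS RS n :: (play CS RS n).2.2.2) = _
        rw [autoF]
        exact dif_pos hex
      have hs := hex.choose_spec
      rw [← hq] at hs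
      have hc : q.1 = copPos CS RS (n + 2) := by
        rw [copPos_succ]
        change q.1 = (autoCop G Inv c0).move (copPos CS RS (n + 1) :: _)
          (robPos CS RS (n + 1) :: (play CS RS (n + 1)).2.2.2)
        rw [autoCop_move, ← i1, if_pos hs.1]
      rcases hs.2 with h | h
      · exact absurd (hc ▸ h) (hcap (n + 1) le_rfl).2
      · refine ⟨hc, h.2.2, fun j hj => ?_⟩
        rcases Nat.lt_or_ge n j with h' | h'
        · obtain rfl : j = n + 1 := by omega
          exact h.2.1
        · exact h.1 (i3 j h')
  rcases (damageSet CS RS).eq_empty_or_nonempty with he | hne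
  · rw [he]; simp
  · choose! f hf using (fun v (hv : v ∈ damageSet CS RS) => hv)
    obtain ⟨v, hv, hmax⟩ := Set.exists_max_image (damageSet CS RS) f (Set.toFinite _) hne
    obtain ⟨m1, m2, m3⟩ := main (f v) (hf v hv).2
    refine (Set.ncard_le_ncard ?_ (Set.toFinite _)).trans (bd _ _ _ m2)
    intro w hw
    have := m3 (f w) (hmax w hw)
    rwa [(hf w hw).1] at this

/-! ### The torus interface -/

/-- The pair `(a, b)` has `ℓ¹`-norm at most `t`. -/
def L1 (a b t : ℤ) : Prop := a + b ≤ t ∧ a - b ≤ t ∧ -a + b ≤ t ∧ -a - b ≤ t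

/-- `π` is a covering of the graph `G` by the grid `ℤ²`, exhibiting `G` as an `m × n` torus. -/
structure IsTorus (G : SimpleGraph V) (m n : ℕ) (π : ℤ → ℤ → V) : Prop where
  eq_iff : ∀ x y x' y', π x y = π x' y' ↔ (m : ℤ) ∣ x - x' ∧ (n : ℤ) ∣ y - y'
  surj : ∀ v, ∃ x y, v = π x y
  nb : ∀ x y v, Nb G (π x y) v ↔ ∃ a b : ℤ, L1 a b 1 ∧ v = π (x + a) (y + b)

theorem dvd_small {m : ℕ} {z : ℤ} (h : (m : ℤ) ∣ z) (h1 : -(m : ℤ) < z) (h2 : z < m) : z = 0 := by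
  obtain ⟨k, rfl⟩ := h
  have hk1 : k < 1 := by
    by_contra hk
    nlinarith
  have hk2 : -1 < k := by
    by_contra hk
    nlinarith
  obtain rfl : k = 0 := by omega
  simp

namespace IsTorus

variable {G : SimpleGraph V} {m n : ℕ} {π : ℤ → ℤ → V}

theorem flipx (h : IsTorus G m n π) : IsTorus G m n (fun x y => π (-x) y) where
  eq_iff x y x' y' := by
    rw [h.eq_iff, show -x - -x' = -(x - x') by ring, dvd_neg]
  surj v := by
    obtain ⟨x, y, rfl⟩ := h.surj v
    exact ⟨-x, y, by simp⟩
  nb x y v := by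
    rw [h.nb]
    constructor
    · rintro ⟨a, b, hab, rfl⟩
      exact ⟨-a, b, by unfold L1 at *; omega, by congr 1; ring⟩
    · rintro ⟨a, b, hab, rfl⟩
      exact ⟨-a, b, by unfold L1 at *; omega, by congr 1; ring⟩

theorem swap (h : IsTorus G m n π) : IsTorus G n m (fun x y => π y x) where
  eq_iff x y x' y' := by
    rw [h.eq_iff, and_comm]
  surj v := by
    obtain ⟨x, y, rfl⟩ := h.surj v
    exact ⟨y, x, rfl⟩
  nb x y v := by
    rw [h.nb]
    constructor
    · rintro ⟨a, b, hab, rfl⟩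
      exact ⟨b, a, by unfold L1 at *; omega, rfl⟩
    · rintro ⟨a, b, hab, rfl⟩
      exact ⟨b, a, by unfold L1 at *; omega, rfl⟩

theorem flipy (h : IsTorus G m n π) : IsTorus G m n (fun x y => π x (-y)) := h.swap.flipx.swap

theorem eq_small (h : IsTorus G m n π) {x y x' y' : ℤ} (e : π x y = π x' y')
    (h1 : -(m : ℤ) < x - x') (h2 : x - x' < m) (h3 : -(n : ℤ) < y - y') (h4 : y - y' < n) :
    x = x' ∧ y = y' := by
  rw [h.eq_iff] at e
  have := dvd_small e.1 h1 h2
  have := dvd_small e.2 h3 h4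
  omega

theorem ne_of_y (h : IsTorus G m n π) {x y x' y' : ℤ}
    (h3 : -(n : ℤ) < y - y') (h4 : y - y' < n) (hne : y ≠ y') : π x y ≠ π x' y' := by
  intro e
  rw [h.eq_iff] at e
  have := dvd_small e.2 h3 h4
  omega

theorem ne_of_x (h : IsTorus G m n π) {x y x' y' : ℤ}
    (h3 : -(m : ℤ) < x - x') (h4 : x - x' < m) (hne : x ≠ x') : π x y ≠ π x' y' := by
  intro e
  rw [h.eq_iff] at e
  have := dvd_small e.1 h3 h4
  omega

theorem nb_mk (h : IsTorus G m n π) {x y x' y' : ℤ} (hl : L1 (x' - x) (y' - y) 1) :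
    Nb G (π x y) (π x' y') :=
  (h.nb _ _ _).2 ⟨_, _, hl, by congr 1 <;> ring⟩

end IsTorus

/-! ### Counting -/

/-- The row at height `y`. -/
def trow (π : ℤ → ℤ → V) (y : ℤ) : Set V := Set.range fun x => π x y

/-- The number of elements of `S` in the row at height `y`. -/
noncomputable def rc (π : ℤ → ℤ → V) (S : Set V) (y : ℤ) : ℕ := (S ∩ trow π y).ncard

section counting

variable [Finite V] {G : SimpleGraph V} {m n : ℕ} {π : ℤ → ℤ → V}

theorem trow_flipx (y : ℤ) : trow (fun x y => π (-x) y) y = trow π y := by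
  ext v
  constructor
  · rintro ⟨x, rfl⟩; exact ⟨-x, rfl⟩
  · rintro ⟨x, rfl⟩; exact ⟨-x, by simp⟩

theorem rc_flipx (S : Set V) (y : ℤ) : rc (fun x y => π (-x) y) S y = rc π S y := by
  unfold rc; rw [trow_flipx]

theorem rc_flipy (S : Set V) (y : ℤ) : rc (fun x y => π x (-y)) S y = rc π S (-y) := rfl

theorem rc_mono {S T : Set V} (h : S ⊆ T) (y : ℤ) : rc π S y ≤ rc π T y :=
  Set.ncard_le_ncard (Set.inter_subset_inter_left _ h) (Set.toFinite _)

theorem trow_eq (h : IsTorus G m n π) {y y' : ℤ} (hd : (n : ℤ) ∣ y - y') :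
    trow π y = trow π y' := by
  unfold trow
  congr 1
  funext x
  rw [h.eq_iff]
  simp [hd]

theorem rc_congr (h : IsTorus G m n π) (S : Set V) {y y' : ℤ} (hd : (n : ℤ) ∣ y - y') :
    rc π S y = rc π S y' := by
  unfold rc; rw [trow_eq h hd]

theorem mem_trow (h : IsTorus G m n π) {x y y' : ℤ} : π x y ∈ trow π y' ↔ (n : ℤ) ∣ y - y' := by
  constructor
  · rintro ⟨x', e⟩
    have := ((h.eq_iff _ _ _ _).1 e).2
    rwa [← dvd_neg, neg_sub] at this
  · intro hd
    rw [← trow_eq h hd]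
    exact ⟨x, rfl⟩

theorem rc_seg (h : IsTorus G m n π) {S : Set V} {x y : ℤ} {d d' t : ℕ}
    (hS : ∀ i : ℤ, -(d' : ℤ) ≤ i → i ≤ d → π (x + i) y ∈ S) (ht : t ≤ d + d' + 1) (hm : t ≤ m) :
    t ≤ rc π S y := by
  classical
  have hinj : Set.InjOn (fun i : ℤ => π (x + i) y) (Finset.Ico (-(d' : ℤ)) (-d' + t)) := by
    intro i hi j hj e
    simp only [Finset.coe_Ico, Set.mem_Ico] at hi hj
    have := dvd_small ((h.eq_iff _ _ _ _).1 e).1 (by omega) (by omega)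
    omega
  have h2 := Set.ncard_image_of_injOn hinj
  rw [Set.ncard_coe_finset, Int.card_Ico] at h2
  have h3 : t = (-(d' : ℤ) + t - -d').toNat := by omega
  rw [h3, ← h2]
  refine Set.ncard_le_ncard ?_ (Set.toFinite _)
  rintro _ ⟨i, hi, rfl⟩
  simp only [Finset.coe_Ico, Set.mem_Ico] at hi
  exact ⟨hS i hi.1 (by omega), ⟨_, rfl⟩⟩

theorem rc_full (h : IsTorus G m n π) {S : Set V} {y : ℤ} (hS : ∀ x, π x y ∈ S) :
    m ≤ rc π S y :=
  rc_seg h (x := 0) (d := m) (d' := 0) (fun _ _ _ => hS _) (by omega) le_rfl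

theorem sum_rc_le (h : IsTorus G m n π) (S : Set V) (y0 : ℤ) :
    ∑ i ∈ Finset.range n, rc π S (y0 + i) ≤ S.ncard := by
  classical
  have : Fintype V := Fintype.ofFinite V
  have e : ∀ i : ℕ, rc π S (y0 + i) = (S ∩ trow π (y0 + i)).toFinset.card := fun i =>
    Set.ncard_eq_toFinset_card' _
  simp only [e]
  rw [← Finset.card_biUnion, Set.ncard_eq_toFinset_card']
  · refine Finset.card_le_card ?_
    intro v hv
    simp only [Finset.mem_biUnion, Set.mem_toFinset] at hv ⊢
    obtain ⟨_, _, hv⟩ := hv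
    exact hv.1
  · intro i hi j hj hij
    simp only [Finset.coe_range, Set.mem_Iio] at hi hj
    rw [Function.onFun, Finset.disjoint_left]
    intro v h1 h2
    simp only [Set.mem_toFinset] at h1 h2
    obtain ⟨x, rfl⟩ := h1.2
    have := dvd_small ((mem_trow h).1 h2.2) (by omega) (by omega)
    omega

theorem sum_rc_range_le (h : IsTorus G m n π) (S : Set V) (y0 : ℤ) {k t : ℕ} (hk : k ≤ n)
    (ht : ∀ i < k, t ≤ rc π S (y0 + i)) : k * t ≤ S.ncard := by
  refine le_trans ?_ (sum_rc_le h S y0)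
  calc k * t = ∑ i ∈ Finset.range k, t := by simp
    _ ≤ ∑ i ∈ Finset.range k, rc π S (y0 + i) :=
        Finset.sum_le_sum fun i hi => ht i (Finset.mem_range.1 hi)
    _ ≤ _ := Finset.sum_le_sum_of_subset (Finset.range_mono hk)

theorem exists_rep (k : ℕ) (hk : 0 < k) (a z : ℤ) :
    ∃ i : ℕ, i < k ∧ (k : ℤ) ∣ z - (a + i) := by
  refine ⟨((z - a) % k).toNat, ?_, ?_⟩
  · have := Int.emod_lt_of_pos (z - a) (show (0 : ℤ) < k by omega)
    have := Int.emod_nonneg (z - a) (show (k : ℤ) ≠ 0 by omega)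
    omega
  · have := Int.emod_nonneg (z - a) (show (k : ℤ) ≠ 0 by omega)
    rw [Int.toNat_of_nonneg this]
    have h := Int.mul_ediv_add_emod (z - a) k
    exact ⟨(z - a) / k, by linarith⟩

end counting

/-! ### The upper bound -/

section upper

variable [Finite V] {G : SimpleGraph V} {m n : ℕ} {π : ℤ → ℤ → V}

/-- Half-interval: those `x` strictly between `(s-m)/2` and `s/2`. -/
def Half (m : ℕ) (s x : ℤ) : Prop := s - m < 2 * x ∧ 2 * x < s

theorem half_move {m : ℕ} {s x a : ℤ} (h : Half m s x) (h1 : -1 ≤ a) (h2 : a ≤ 1) :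
    Half m s (x + a) ∨ ∃ δ : ℤ, -1 ≤ δ ∧ δ ≤ 1 ∧ a ≠ 0 ∧ (m : ℤ) ∣ (s - x + δ) - (x + a) := by
  unfold Half at *
  by_cases hc : s - m < 2 * (x + a) ∧ 2 * (x + a) < s
  · exact Or.inl hc
  · right
    have ha : a = 1 ∨ a = -1 := by omega
    rcases ha with rfl | rfl
    · rcases (show s = 2 * x + 1 ∨ s = 2 * x + 2 by omega) with rfl | rfl
      · exact ⟨0, by omega, by omega, by omega, by ring_nf; simp⟩
      · exact ⟨-1, by omega, by omega, by omega, by ring_nf; simp⟩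
    · rcases (show s = 2 * x - 1 + m ∨ s = 2 * x - 2 + m by omega) with rfl | rfl
      · exact ⟨0, by omega, by omega, by omega, by ring_nf; simp⟩
      · exact ⟨1, by omega, by omega, by omega, by ring_nf; simp⟩

/-- The damage region of an `X`-state. -/
def regX (π : ℤ → ℤ → V) (m : ℕ) (s : ℤ) : Set V := {v | ∃ x y, v = π x y ∧ Half m s x}

/-- The damage region of a `Y`-state. -/
def regY (π : ℤ → ℤ → V) (n : ℕ) (t : ℤ) : Set V := {v | ∃ x y, v = π x y ∧ Half n t y}

/-- The damage region of a `Q`-state. -/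
def regQ (π : ℤ → ℤ → V) (m n : ℕ) (s t : ℤ) : Set V :=
  {v | ∃ x y, v = π x y ∧ Half m s x ∧ Half n t y}

theorem regX_card (h : IsTorus G m n π) (hn : 0 < n) {s : ℤ} (hp : m % 2 = 1 ∨ s % 2 = 0) :
    (regX π m s).ncard ≤ (m - 1) / 2 * n := by
  classical
  let a : ℤ := (s - m) / 2 + 1
  let F : Finset (ℤ × ℤ) := Finset.Ico a (a + ((m - 1) / 2 : ℕ)) ×ˢ Finset.Ico 0 (0 + (n : ℤ))
  have hF : F.card = (m - 1) / 2 * n := by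
    simp only [F, Finset.card_product, Int.card_Ico]
    congr 1 <;> omega
  have hsub : regX π m s ⊆ Set.image (fun z : ℤ × ℤ => π z.1 z.2) (F : Set (ℤ × ℤ)) := by
    rintro v ⟨x, y, rfl, hx⟩
    obtain ⟨i, hi, hd⟩ := exists_rep n hn 0 y
    refine ⟨(x, 0 + i), ?_, ?_⟩
    · simp only [F, Finset.coe_product, Set.mem_prod, Finset.coe_Ico, Set.mem_Ico]
      unfold Half at hx
      refine ⟨?_, by omega⟩
      simp only [a]
      omega
    · rw [h.eq_iff]
      refine ⟨by simp, ?_⟩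
      rwa [← dvd_neg, neg_sub]
  calc _ ≤ _ := Set.ncard_le_ncard hsub (Set.toFinite _)
    _ ≤ _ := Set.ncard_image_le (Set.toFinite _)
    _ = _ := by rw [Set.ncard_coe_finset, hF]

theorem regY_card (h : IsTorus G m n π) (hm : 0 < m) {t : ℤ} (hp : n % 2 = 1 ∨ t % 2 = 0) :
    (regY π n t).ncard ≤ (n - 1) / 2 * m := by
  refine le_trans (Set.ncard_le_ncard ?_ (Set.toFinite _)) (regX_card h.swap hm hp)
  rintro v ⟨x, y, h1, h2⟩
  exact ⟨y, x, h1, h2⟩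

/-- The cop's invariant. -/
def CInv (π : ℤ → ℤ → V) (m n : ℕ) (c r : V) (D : Set V) : Prop :=
  (∃ s t x y, r = π x y ∧ c = π (s - x) (t - y) ∧ Half m s x ∧ Half n t y ∧
    (m % 2 = 1 ∨ s % 2 = 0) ∧ (n % 2 = 1 ∨ t % 2 = 0) ∧ D = regQ π m n s t) ∨
  (∃ s x y, r = π x y ∧ c = π (s - x) y ∧ Half m s x ∧
    (m % 2 = 1 ∨ s % 2 = 0) ∧ D = regX π m s) ∨
  (∃ t x y, r = π x y ∧ c = π x (t - y) ∧ Half n t y ∧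
    (n % 2 = 1 ∨ t % 2 = 0) ∧ D = regY π n t)

theorem cinv_step (h : IsTorus G m n π) (c r : V) (D : Set V) (r' : V) (hI : CInv π m n c r D)
    (hnb : Nb G r r') : ∃ c', Nb G c c' ∧
      (c' = r' ∨ ∃ D' : Set V, D ⊆ D' ∧ r' ∈ D' ∧ CInv π m n c' r' D') := by
  rcases hI with ⟨s, t, x, y, rfl, rfl, hx, hy, ps, pt, rfl⟩ | ⟨s, x, y, rfl, rfl, hx, ps, rfl⟩ |
    ⟨t, x, y, rfl, rfl, hy, pt, rfl⟩
  · obtain ⟨a, b, hab, rfl⟩ := (h.nb _ _ _).1 hnb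
    unfold L1 at hab
    rcases half_move hx (show -1 ≤ a by omega) (by omega) with hx' | ⟨δ, d1, d2, ha, hd⟩
    · rcases half_move hy (show -1 ≤ b by omega) (by omega) with hy' | ⟨δ, d1, d2, hb, hd⟩
      · refine ⟨π (s - (x + a)) (t - (y + b)), h.nb_mk (by unfold L1; omega), Or.inr
          ⟨_, subset_rfl, ⟨_, _, rfl, hx', hy'⟩, Or.inl ⟨s, t, _, _, rfl, rfl, hx', hy', ps, pt,
            rfl⟩⟩⟩
      · obtain rfl : a = 0 := by omega
        refine ⟨π (s - x) (t - y + δ), h.nb_mk (by unfold L1; omega), Or.inr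
          ⟨regX π m s, ?_, ⟨_, _, rfl, hx'⟩, Or.inr (Or.inl ⟨s, _, _, rfl, ?_, hx', ps, rfl⟩)⟩⟩
        · rintro v ⟨x, y, e, h1, h2⟩
          exact ⟨x, y, e, h1⟩
        · rw [h.eq_iff]
          exact ⟨by simp, hd⟩
    · obtain rfl : b = 0 := by omega
      refine ⟨π (s - x + δ) (t - y), h.nb_mk (by unfold L1; omega), Or.inr
        ⟨regY π n t, ?_, ⟨_, _, rfl, by simpa using hy⟩, Or.inr (Or.inr ⟨t, _, _, rfl, ?_,
          by simpa using hy, pt, rfl⟩)⟩⟩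
      · rintro v ⟨x, y, e, h1, h2⟩
        exact ⟨x, y, e, h2⟩
      · rw [h.eq_iff]
        exact ⟨hd, by simp⟩
  · obtain ⟨a, b, hab, rfl⟩ := (h.nb _ _ _).1 hnb
    unfold L1 at hab
    rcases half_move hx (show -1 ≤ a by omega) (by omega) with hx' | ⟨δ, d1, d2, ha, hd⟩
    · refine ⟨π (s - (x + a)) (y + b), h.nb_mk (by unfold L1; omega), Or.inr
          ⟨_, subset_rfl, ⟨_, _, rfl, hx'⟩, Or.inr (Or.inl ⟨s, _, _, rfl, rfl, hx', ps, rfl⟩)⟩⟩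
    · obtain rfl : b = 0 := by omega
      refine ⟨π (s - x + δ) y, h.nb_mk (by unfold L1; omega), Or.inl ?_⟩
      rw [h.eq_iff]
      exact ⟨hd, by simp⟩
  · obtain ⟨a, b, hab, rfl⟩ := (h.nb _ _ _).1 hnb
    unfold L1 at hab
    rcases half_move hy (show -1 ≤ b by omega) (by omega) with hy' | ⟨δ, d1, d2, ha, hd⟩
    · refine ⟨π (x + a) (t - (y + b)), h.nb_mk (by unfold L1; omega), Or.inr
          ⟨_, subset_rfl, ⟨_, _, rfl, hy'⟩, Or.inr (Or.inr ⟨t, _, _, rfl, rfl, hy', pt, rfl⟩)⟩⟩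
    · obtain rfl : a = 0 := by omega
      refine ⟨π x (t - y + δ), h.nb_mk (by unfold L1; omega), Or.inl ?_⟩
      rw [h.eq_iff]
      exact ⟨by simp, hd⟩

theorem torus_upper (h : IsTorus G m n π) (hn : 0 < n) (hodd : m % 2 = 1) :
    dmg G ≤ max ((m - 1) / 2 * n) ((n - 1) / 2 * m) := by
  refine cop_bound (CInv π m n) (π 0 0) _ ?_ (cinv_step h) ?_
  · intro r0 hr0
    obtain ⟨x0, y0, rfl⟩ := h.surj r0
    obtain ⟨i, hi, hdi⟩ := exists_rep m (by omega) (-(m : ℤ) + 1) x0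
    obtain ⟨j, hj, hdj⟩ := exists_rep n (by omega) (-(n : ℤ) + 1) y0
    obtain ⟨x, hx⟩ : ∃ x, x = -(m : ℤ) + 1 + i := ⟨_, rfl⟩
    obtain ⟨y, hy⟩ : ∃ y, y = -(n : ℤ) + 1 + j := ⟨_, rfl⟩
    have e : π x0 y0 = π x y := by
      rw [h.eq_iff, hx, hy]; exact ⟨hdi, hdj⟩
    rw [e] at hr0 ⊢
    obtain ⟨δ, h0, h1, hpar⟩ : ∃ δ : ℤ, 0 ≤ δ ∧ δ ≤ 1 ∧
        ((n % 2 = 1 ∧ δ = 0) ∨ (n % 2 = 0 ∧ (y + δ) % 2 = 0)) := by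
      rcases Nat.mod_two_eq_zero_or_one n with h' | h'
      · rcases Int.emod_two_eq_zero_or_one y with h'' | h''
        · exact ⟨0, by omega, by omega, by omega⟩
        · exact ⟨1, by omega, by omega, by omega⟩
      · exact ⟨0, by omega, by omega, by omega⟩
    refine ⟨π 0 δ, h.nb_mk (by unfold L1; omega), ?_⟩
    by_cases hrow : (y = 0 ∧ δ = 0) ∨ (y = 1 - n ∧ δ = 1)
    · have hd : (n : ℤ) ∣ δ - y := by
        rcases hrow with ⟨rfl, rfl⟩ | ⟨hy', rfl⟩
        · simp
        · rw [hy']; simp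
      by_cases hx0 : x = 0
      · left
        rw [h.eq_iff, hx0]
        exact ⟨by simp, hd⟩
      · right
        refine ⟨regX π m x, ⟨x, y, rfl, ?_⟩, Or.inr (Or.inl ⟨x, x, y, rfl, ?_, ?_, Or.inl hodd,
          rfl⟩)⟩
        · unfold Half; omega
        · rw [h.eq_iff]
          exact ⟨by simp, hd⟩
        · unfold Half; omega
    · right
      have hH : Half n (y + δ) y := by unfold Half; omega
      by_cases hx0 : x = 0
      · exact ⟨regY π n (y + δ), ⟨x, y, rfl, hH⟩, Or.inr (Or.inr ⟨y + δ, x, y, rfl,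
          by rw [hx0]; congr 1; ring, hH, by omega, rfl⟩)⟩
      · have hH' : Half m x x := by unfold Half; omega
        exact ⟨regQ π m n x (y + δ), ⟨x, y, rfl, hH', hH⟩, Or.inl ⟨x, y + δ, x, y, rfl,
          by congr 1 <;> ring, hH', hH, Or.inl hodd, by omega, rfl⟩⟩
  · intro c r D hI
    rcases hI with ⟨s, t, x, y, rfl, rfl, hx, hy, ps, pt, rfl⟩ | ⟨s, x, y, rfl, rfl, hx, ps, rfl⟩ |
      ⟨t, x, y, rfl, rfl, hy, pt, rfl⟩
    · refine le_trans (Set.ncard_le_ncard ?_ (Set.toFinite _))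
        ((regX_card h hn ps).trans (le_max_left _ _))
      rintro v ⟨x, y, e, h1, h2⟩
      exact ⟨x, y, e, h1⟩
    · exact (regX_card h hn ps).trans (le_max_left _ _)
    · exact (regY_card h (by omega) pt).trans (le_max_right _ _)

end upper

/-! ### Stuck configurations in the free game -/

/-- A stuck family of states for the game in which the robber stays in `R`. -/
structure Stk (G : SimpleGraph V) (R S : Set V) (P : V → V → Prop) : Prop where
  mem : ∀ c r, P c r → c ≠ r ∧ r ∈ R ∧ r ∈ S
  cl : ∀ c r r', P c r → Nb G r r' → r' ∈ R → (∀ c', Nb G c c' → c' ≠ r') → ∃ c', Nb G c c' ∧ P c' r'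

theorem exists_stk [Finite V] {G : SimpleGraph V} {Goal : V → V → Set V → Prop} (R : Set V)
    {c0 r0 : V} {S0 : Set V} (h0 : c0 ≠ r0) (hR : r0 ∈ R) (hr : r0 ∈ S0)
    (hn : ¬ Reach G Goal c0 r0 S0) :
    ∃ (S : Set V) (P : V → V → Prop), S0 ⊆ S ∧ (∃ c r, P c r) ∧ Stk G R S P ∧
      ∀ c r, P c r → ¬ Goal c r S := by
  obtain ⟨S, P, h1, h2, h3, h4⟩ := stuck (G := G) (Goal := Goal) (fun c r => c ≠ r ∧ r ∈ R)
    ⟨h0, hR⟩ hr hn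
  refine ⟨S, P, h1, h2, ⟨fun c r h => ⟨(h3 c r h).1.1, (h3 c r h).1.2, (h3 c r h).2.1⟩, ?_⟩, ?_⟩
  · intro c r r' hP hnb hR' hall
    exact h4 c r r' hP hnb (fun c' hc' => ⟨hall c' hc', hall c' hc', hR'⟩)
  · intro c r hP hg
    exact (h3 c r hP).2.2 (Reach.done _ _ _ hg)

/-- Lifted states. -/
def St (π : ℤ → ℤ → V) (P : V → V → Prop) (x y k β : ℤ) : Prop := P (π (x + k) (y + β)) (π x y)

/-- The robber move `(a, b)` cannot be answered by a capture. -/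
def FreeMv (m n : ℕ) (k β a b : ℤ) : Prop :=
  ∀ a' b' : ℤ, L1 a' b' 1 → ¬ ((m : ℤ) ∣ k + a' - a ∧ (n : ℤ) ∣ β + b' - b)

section free

variable {G : SimpleGraph V} {m n : ℕ} {π : ℤ → ℤ → V} {R S : Set V}
  {P : V → V → Prop}

theorem st_congr (h : IsTorus G m n π) {x y k β x' y' k' β' : ℤ} (hs : St π P x y k β)
    (h1 : (m : ℤ) ∣ x - x') (h2 : (n : ℤ) ∣ y - y') (h3 : (m : ℤ) ∣ k - k')
    (h4 : (n : ℤ) ∣ β - β') : St π P x' y' k' β' := by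
  unfold St at *
  have e1 : π x y = π x' y' := (h.eq_iff _ _ _ _).2 ⟨h1, h2⟩
  have e2 : π (x + k) (y + β) = π (x' + k') (y' + β') := by
    rw [h.eq_iff]
    constructor
    · have := dvd_add h1 h3
      rwa [show x - x' + (k - k') = x + k - (x' + k') by ring] at this
    · have := dvd_add h2 h4
      rwa [show y - y' + (β - β') = y + β - (y' + β') by ring] at this
  rwa [← e1, ← e2]

theorem st_of (h : IsTorus G m n π) {c r : V} (hP : P c r) : ∃ x y k β, r = π x y ∧
    c = π (x + k) (y + β) ∧ St π P x y k β := by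
  obtain ⟨x, y, rfl⟩ := h.surj r
  obtain ⟨x', y', rfl⟩ := h.surj c
  refine ⟨x, y, x' - x, y' - y, rfl, by congr 1 <;> ring, ?_⟩
  unfold St
  convert hP using 2 <;> ring

theorem st_ne (h : IsTorus G m n π) (hk : Stk G R S P) {x y k β : ℤ} (hs : St π P x y k β) :
    ¬ ((m : ℤ) ∣ k ∧ (n : ℤ) ∣ β) := by
  have := (hk.mem _ _ hs).1
  rw [Ne, h.eq_iff] at this
  simpa using this

theorem move_free (h : IsTorus G m n π) (hk : Stk G R S P) {x y k β a b : ℤ}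
    (hs : St π P x y k β) (hab : L1 a b 1) (hR : π (x + a) (y + b) ∈ R) (hf : FreeMv m n k β a b) :
    ∃ k' β', L1 (k' - k + a) (β' - β + b) 1 ∧ St π P (x + a) (y + b) k' β' := by
  obtain ⟨c', hc', hP⟩ := hk.cl _ _ (π (x + a) (y + b)) hs
    ((h.nb _ _ _).2 ⟨a, b, hab, rfl⟩) hR (by
      intro c' hc' e
      obtain ⟨a', b', hab', rfl⟩ := (h.nb _ _ _).1 hc'
      rw [h.eq_iff] at e
      apply hf a' b' hab'
      rwa [show k + a' - a = x + k + a' - (x + a) by ring,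
        show β + b' - b = y + β + b' - (y + b) by ring])
  obtain ⟨a', b', hab', rfl⟩ := (h.nb _ _ _).1 hc'
  refine ⟨k + a' - a, β + b' - b, ?_, ?_⟩
  · unfold L1 at *; omega
  · unfold St
    convert hP using 2 <;> ring

theorem run_right (h : IsTorus G m n π) (hk : Stk G R S P) {x y k β : ℤ}
    (hR : trow π y ⊆ R) (hs : St π P x y k β) (h0 : 0 < k) (hm : k ≤ m) :
    ∃ d : ℕ, (∀ i : ℤ, 0 ≤ i → i ≤ d → π (x + i) y ∈ S) ∧ k ≤ 2 * d + 2 := by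
  by_contra hcon
  push Not at hcon
  have main : ∀ j : ℕ, (∀ i : ℤ, 0 ≤ i → i ≤ j → π (x + i) y ∈ S) ∧
      ∃ k' β', L1 (k' - (k - j)) (β' - β) j ∧ St π P (x + j) y k' β' := by
    intro j
    induction j with
    | zero =>
      refine ⟨?_, k, β, by unfold L1; simp, by simpa using hs⟩
      intro i h1 h2
      obtain rfl : i = 0 := by simp at h2; omega
      simpa using (hk.mem _ _ hs).2.2
    | succ j ih =>
      obtain ⟨ih1, k', β', hl, hst⟩ := ih
      have hc := hcon j ih1
      have hfree : FreeMv m n k' β' 1 0 := by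
        rintro a' b' hab ⟨d1, d2⟩
        unfold L1 at *
        have hz := dvd_small (m := m) (z := k' + a' - 1) d1
        have hz2 : (m : ℤ) ∣ k' + a' - 1 - m := by simpa using d1
        by_cases hcase : k' + a' - 1 < m
        · have := hz (by omega) hcase
          omega
        · have e1 : k = m := by omega
          have e2 : a' = 1 := by omega
          have e3 : b' = 0 := by omega
          have e4 : β' = β := by omega
          apply st_ne h hk hs
          rw [e1]
          refine ⟨by simp, ?_⟩
          rw [e3, e4] at d2
          simpa using d2
      obtain ⟨k2, β2, hl2, hst2⟩ := move_free h hk hst (a := 1) (b := 0) (by unfold L1; omega)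
        (hR ⟨x + j + 1, by simp⟩) hfree
      have hst3 : St π P (x + (j + 1 : ℕ)) y k2 β2 := by
        convert hst2 using 1 <;> push_cast <;> ring
      refine ⟨?_, k2, β2, ?_, hst3⟩
      · intro i h1 h2
        by_cases hi : i ≤ j
        · exact ih1 i h1 hi
        · obtain rfl : i = (j + 1 : ℕ) := by omega
          exact (hk.mem _ _ hst3).2.2
      · unfold L1 at *; push_cast; omega
  have := hcon m (main m).1
  omega

theorem row_p [Finite V] (h : IsTorus G m n π) (hm : 0 < m) (hk : Stk G R S P) {x y k β : ℤ}
    (hR : trow π y ⊆ R) (hs : St π P x y k β) : (m - 1) / 2 ≤ rc π S y := by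
  obtain ⟨i, hi, hd⟩ := exists_rep m hm 1 k
  have hs' : St π P x y (1 + i) β := st_congr h hs (by simp) (by simp) hd (by simp)
  obtain ⟨d, h1, h2⟩ := run_right h hk hR hs' (by omega) (by omega)
  obtain ⟨d', h3, h4⟩ : ∃ d : ℕ, (∀ i : ℤ, 0 ≤ i → i ≤ d → π (x - i) y ∈ S) ∧
      m - (1 + i : ℤ) ≤ 2 * d + 2 := by
    by_cases hi' : m = i + 1
    · refine ⟨0, ?_, by omega⟩
      intro i h1 h2
      obtain rfl : i = 0 := by simp at h2; omega
      simpa using (hk.mem _ _ hs).2.2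
    · obtain ⟨d, h1, h2⟩ := run_right (x := -x) (k := m - (1 + i)) (β := β) h.flipx hk
        (by rw [trow_flipx]; exact hR) (by
          have := st_congr (k' := 1 + i - m) h hs' (x' := x) (y' := y) (β' := β)
            (by simp) (by simp) (by simp) (by simp)
          unfold St at *
          convert this using 2 <;> ring) (by omega) (by omega)
      refine ⟨d, fun i h3 h4 => ?_, h2⟩
      have := h1 i h3 h4
      convert this using 2
      ring
  refine rc_seg h (x := x) (d := d) (d' := d') ?_ (by omega) (by omega)
  intro i h5 h6
  rcases le_total 0 i with hi0 | hi0
  · exact h1 i hi0 h6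
  · have := h3 (-i) (by omega) (by omega)
    simpa using this

/-- Normalised guarded states. -/
def GNorm (k β : ℤ) : Prop := L1 k (β - 1) 1 ∧ 1 ≤ β

theorem guard_norm (h : IsTorus G m n π) (hk : Stk G R S P) {x y k β : ℤ}
    (hs : St π P x y k β) (hf : ¬ FreeMv m n k β 0 1) :
    ∃ k' β', GNorm k' β' ∧ St π P x y k' β' ∧ (m : ℤ) ∣ k - k' := by
  unfold FreeMv at hf
  push Not at hf
  obtain ⟨a', b', hab, d1, d2⟩ := hf
  have hs' : St π P x y (-a') (1 - b') := by
    refine st_congr h hs (by simp) (by simp) ?_ ?_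
    · simpa using d1
    · rwa [show β - (1 - b') = β + b' - 1 by ring]
  refine ⟨-a', 1 - b', ?_, hs', by simpa using d1⟩
  have := st_ne h hk hs'
  unfold GNorm
  unfold L1 at *
  refine ⟨by omega, ?_⟩
  by_contra hlt
  apply this
  obtain rfl : a' = 0 := by omega
  obtain rfl : b' = 1 := by omega
  simp

theorem guarded_right (h : IsTorus G m n π) (hm : 5 ≤ m) (hn : 4 ≤ n) (hk : Stk G R S P) {y : ℤ}
    (hR : trow π y ⊆ R) (hg : ∀ x k β, St π P x y k β → ¬ FreeMv m n k β 0 1) {x k β : ℤ}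
    (hs : St π P x y k β) (hN : GNorm k β) (h0 : k ≤ 0) :
    ∀ x', ∃ k' β', St π P x' y k' β' ∧ GNorm k' β' := by
  have main : ∀ j : ℕ, ∃ k' β', St π P (x + j) y k' β' ∧ GNorm k' β' ∧ k' ≤ 0 := by
    intro j
    induction j with
    | zero => exact ⟨k, β, by simpa using hs, hN, h0⟩
    | succ j ih =>
      obtain ⟨k', β', hst, hN', hk'⟩ := ih
      unfold GNorm L1 at hN'
      have hfree : FreeMv m n k' β' 1 0 := by
        rintro a' b' hab ⟨d1, d2⟩
        unfold L1 at *
        have := dvd_small d1 (by omega) (by omega)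
        have := dvd_small d2 (by omega) (by omega)
        omega
      obtain ⟨k2, β2, hl2, hst2⟩ := move_free h hk hst (a := 1) (b := 0) (by unfold L1; omega)
        (hR ⟨x + j + 1, by simp⟩) hfree
      have hst3 : St π P (x + (j + 1 : ℕ)) y k2 β2 := by
        convert hst2 using 1 <;> push_cast <;> ring
      obtain ⟨k3, β3, hN3, hst4, hd⟩ := guard_norm h hk hst3 (hg _ _ _ hst3)
      refine ⟨k3, β3, hst4, hN3, ?_⟩
      unfold GNorm L1 at hN3
      unfold L1 at hl2
      have := dvd_small hd (by omega) (by omega)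
      omega
  intro x'
  obtain ⟨i, _, hd⟩ := exists_rep m (by omega) x x'
  obtain ⟨k', β', h1, h2, _⟩ := main i
  refine ⟨k', β', st_congr h h1 ?_ (by simp) (by simp) (by simp), h2⟩
  rwa [← dvd_neg, neg_sub]

theorem guarded [Finite V] (h : IsTorus G m n π) (hm : 5 ≤ m) (hn : 4 ≤ n) (hk : Stk G R S P) {y : ℤ}
    (hR : trow π y ⊆ R) (hg : ∀ x k β, St π P x y k β → ¬ FreeMv m n k β 0 1) {x k β : ℤ}
    (hs : St π P x y k β) :
    ∀ x', ∃ k' β', St π P x' y k' β' ∧ GNorm k' β' := by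
  obtain ⟨k1, β1, hN, hs1, _⟩ := guard_norm h hk hs (hg _ _ _ hs)
  have conv : ∀ x k β, St (fun x y => π (-x) y) P x y k β → St π P (-x) y (-k) β := by
    intro x k β hh
    unfold St at *
    convert hh using 2
    ring
  rcases le_total k1 0 with h0 | h0
  · exact guarded_right h hm hn hk hR hg hs1 hN h0
  · intro x'
    obtain ⟨k', β', h1, h2⟩ := guarded_right (x := -x) (k := -k1) (β := β1) h.flipx hm hn hk
      (by rw [trow_flipx]; exact hR) (by
        intro x k β hh hf
        apply hg _ _ _ (conv x k β hh)
        rintro a' b' hab ⟨d1, d2⟩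
        apply hf (-a') b' (by unfold L1 at *; omega)
        refine ⟨?_, d2⟩
        rw [← dvd_neg]
        rwa [show -(k + -a' - 0) = -k + a' - 0 by ring]) (by
          unfold St at *
          convert hs1 using 2 <;> ring) (by unfold GNorm L1 at *; omega) (by omega) (-x')
    refine ⟨-k', β', by simpa using conv _ _ _ h1, by unfold GNorm L1 at *; omega⟩

theorem down_run (h : IsTorus G m n π) (hk : Stk G R S P) (hR : R = Set.univ) {x y k β : ℤ}
    (hs : St π P x y k β) (hN : GNorm k β) : ∀ j : ℕ, 2 * j + 2 ≤ n - 1 →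
      ∃ k' β', St π P x (y - j) k' β' ∧ L1 k' (β' - (j + 1)) (j + 1) ∧ 1 ≤ β' := by
  intro j
  induction j with
  | zero =>
    intro _
    exact ⟨k, β, by simpa using hs, by unfold GNorm L1 at *; omega, hN.2⟩
  | succ j ih =>
    intro hj
    obtain ⟨k', β', hst, hl, hb⟩ := ih (by omega)
    have hfree : FreeMv m n k' β' 0 (-1) := by
      rintro a' b' hab ⟨d1, d2⟩
      unfold L1 at *
      have := dvd_small d2 (by omega) (by omega)
      omega
    obtain ⟨k2, β2, hl2, hst2⟩ := move_free h hk hst (a := 0) (b := -1) (by unfold L1; omega)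
      (by rw [hR]; trivial) hfree
    refine ⟨k2, β2, ?_, ?_, ?_⟩
    · convert hst2 using 1 <;> push_cast <;> ring
    · unfold L1 at *; push_cast; omega
    · unfold L1 at *; omega

end free

/-! ### Phase 2 and forward lemmas -/

/-- Every window of `n - q` consecutive rows contains at least `E` damaged vertices. -/
def Ex (π : ℤ → ℤ → V) (n q E : ℕ) (S : Set V) : Prop :=
  ∀ y0 : ℤ, E ≤ ∑ i ∈ Finset.range (n - q), rc π S (y0 + i)

section phase2

variable [Finite V] {G : SimpleGraph V} {m n : ℕ} {π : ℤ → ℤ → V}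

theorem Ex.mono {q E : ℕ} {S T : Set V} (h : Ex π n q E S) (hST : S ⊆ T) : Ex π n q E T :=
  fun y0 => (h y0).trans (Finset.sum_le_sum fun _ _ => rc_mono hST _)

theorem phase2 (h : IsTorus G m n π) (hm : 5 ≤ m) (hn : 4 ≤ n) {c r : V} {S0 : Set V}
    (hne : c ≠ r) (hr : r ∈ S0)
    (hE : Ex π n ((n - 1) / 2) ((m - 1) / 2 * n - (n - 1) / 2 * m) S0) :
    Reach G (fun _ _ S => (m - 1) / 2 * n ≤ S.ncard) c r S0 := by
  by_contra hcon
  obtain ⟨S, P, hS, ⟨c1, r1, hP⟩, hk, hng⟩ := exists_stk Set.univ hne trivial hr hcon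
  obtain ⟨x, y, k, β, -, -, hs⟩ := st_of h hP
  apply hng _ _ hP
  by_cases hup : ∀ y, (∃ x k β, St π P x y k β) → ∃ x k β, St π P x (y + 1) k β
  · have hall : ∀ i : ℕ, ∃ x k β, St π P x (y + i) k β := by
      intro i
      induction i with
      | zero => exact ⟨x, k, β, by simpa using hs⟩
      | succ i ih =>
        obtain ⟨x', k', β', h'⟩ := hup _ ih
        exact ⟨x', k', β', by push_cast; rwa [← add_assoc]⟩
    rw [mul_comm]
    refine sum_rc_range_le h S y le_rfl fun i _ => ?_
    obtain ⟨x', k', β', h'⟩ := hall i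
    exact row_p h (by omega) hk (Set.subset_univ _) h'
  · push Not at hup
    obtain ⟨y, ⟨x, k, β, hs⟩, hno⟩ := hup
    have hg : ∀ x k β, St π P x y k β → ¬ FreeMv m n k β 0 1 := by
      intro x k β hs hf
      obtain ⟨k', β', -, h2⟩ := move_free h hk hs (by unfold L1; omega) trivial hf
      exact hno _ _ _ h2
    have hrow := guarded h hm hn hk (Set.subset_univ _) hg hs
    have hfull : ∀ j : ℕ, j < (n - 1) / 2 → m ≤ rc π S (y - j) := by
      intro j hj
      refine rc_full h fun x' => ?_
      obtain ⟨k', β', h1, h2⟩ := hrow x'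
      obtain ⟨k2, β2, h3, -, -⟩ := down_run h hk rfl h1 h2 j (by omega)
      exact (hk.mem _ _ h3).2.2
    refine le_trans ?_ (sum_rc_le h S (y + 1 - ((n - 1) / 2 : ℕ)))
    have hsplit := Finset.sum_range_add (fun i : ℕ => rc π S (y + 1 - ((n - 1) / 2 : ℕ) + i))
      ((n - 1) / 2) (n - (n - 1) / 2)
    rw [show (n - 1) / 2 + (n - (n - 1) / 2) = n by omega] at hsplit
    rw [hsplit]
    have h1 : (n - 1) / 2 * m ≤ ∑ i ∈ Finset.range ((n - 1) / 2),
        rc π S (y + 1 - ((n - 1) / 2 : ℕ) + i) := by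
      calc (n - 1) / 2 * m = ∑ i ∈ Finset.range ((n - 1) / 2), m := by simp
        _ ≤ _ := Finset.sum_le_sum fun i hi => by
          rw [Finset.mem_range] at hi
          have := hfull ((n - 1) / 2 - 1 - i) (by omega)
          rwa [show y - (((n - 1) / 2 - 1 - i : ℕ) : ℤ) = y + 1 - ((n - 1) / 2 : ℕ) + i by
            omega] at this
    have h2 := hE.mono hS (y + 1)
    have h3 : ∑ i ∈ Finset.range (n - (n - 1) / 2), rc π S (y + 1 + i) =
        ∑ i ∈ Finset.range (n - (n - 1) / 2),
          rc π S (y + 1 - ((n - 1) / 2 : ℕ) + ((n - 1) / 2 + i : ℕ)) := by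
      refine Finset.sum_congr rfl fun i _ => ?_
      congr 1
      push_cast
      ring
    rw [← h3]
    omega

theorem row_reach (h : IsTorus G m n π) (hm : 0 < m) {c r : V} {S0 : Set V} {w : ℤ}
    (hne : c ≠ r) (hr : r ∈ S0) (hw : r ∈ trow π w) :
    Reach G (fun c r S => c ≠ r ∧ r ∈ S ∧ S0 ⊆ S ∧ r ∈ trow π w ∧ (m - 1) / 2 ≤ rc π S w)
      c r S0 := by
  by_contra hcon
  obtain ⟨S, P, hS, ⟨c1, r1, hP⟩, hk, hng⟩ := exists_stk (trow π w) hne hw hr hcon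
  obtain ⟨m1, m2, m3⟩ := hk.mem _ _ hP
  obtain ⟨x, y, k, β, e, -, hs⟩ := st_of h hP
  have hd : (n : ℤ) ∣ y - w := by rw [e] at m2; exact (mem_trow h).1 m2
  refine hng _ _ hP ⟨m1, m3, hS, m2, ?_⟩
  have := row_p h hm hk (trow_eq h hd).subset hs
  rwa [rc_congr h S hd] at this

theorem ascend_reach (h : IsTorus G m n π) (hm : 5 ≤ m) (hn : 4 ≤ n) {c r : V} {S0 : Set V} {w : ℤ}
    (hne : c ≠ r) (hr : r ∈ S0) (hw : r ∈ trow π w) :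
    Reach G (fun c r S => c ≠ r ∧ r ∈ S ∧ S0 ⊆ S ∧
      (r ∈ trow π (w + 1) ∨ r ∈ trow π w ∧ m ≤ rc π S w)) c r S0 := by
  by_contra hcon
  obtain ⟨S, P, hS, ⟨c1, r1, hP⟩, hk, hng⟩ := exists_stk (trow π w ∪ trow π (w + 1)) hne
    (Or.inl hw) hr hcon
  have hnot : ∀ c r, P c r → r ∉ trow π (w + 1) := by
    intro c r hP hr
    obtain ⟨m1, m2, m3⟩ := hk.mem _ _ hP
    exact hng _ _ hP ⟨m1, m3, hS, Or.inl hr⟩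
  obtain ⟨m1, m2, m3⟩ := hk.mem _ _ hP
  have m2' : r1 ∈ trow π w := m2.resolve_right (hnot _ _ hP)
  obtain ⟨x, y, k, β, e, -, hs⟩ := st_of h hP
  have hd : (n : ℤ) ∣ y - w := by rw [e] at m2'; exact (mem_trow h).1 m2'
  have hs' : St π P x w k β := st_congr h hs (by simp) hd (by simp) (by simp)
  refine hng _ _ hP ⟨m1, m3, hS, Or.inr ⟨m2', ?_⟩⟩
  refine rc_full h fun x' => ?_
  obtain ⟨k', β', h1, h2⟩ := guarded h hm hn hk Set.subset_union_left (by
    intro x k β hs hf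
    obtain ⟨k', β', -, h2⟩ := move_free h hk hs (by unfold L1; omega) (Or.inr ⟨_, rfl⟩) hf
    exact hnot _ _ h2 ⟨_, rfl⟩) hs' x'
  exact (hk.mem _ _ h1).2.2

theorem descend_reach (h : IsTorus G m n π) (hm : 5 ≤ m) (hn : 4 ≤ n) {c r : V} {S0 : Set V} {w : ℤ}
    (hne : c ≠ r) (hr : r ∈ S0) (hw : r ∈ trow π w) :
    Reach G (fun c r S => c ≠ r ∧ r ∈ S ∧ S0 ⊆ S ∧
      (r ∈ trow π (w - 1) ∨ r ∈ trow π w ∧ m ≤ rc π S w)) c r S0 := by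
  have := ascend_reach (w := -w) h.flipy hm hn hne hr (by
    change r ∈ trow π (- -w)
    rwa [neg_neg])
  refine this.bind fun c r S hg => Reach.done _ _ _ ?_
  obtain ⟨h1, h2, h3, h4⟩ := hg
  refine ⟨h1, h2, h3, ?_⟩
  rcases h4 with h4 | ⟨h4, h5⟩
  · left
    change r ∈ trow π (-(-w + 1)) at h4
    rwa [show -(-w + 1) = w - 1 by ring] at h4
  · right
    change r ∈ trow π (- -w) at h4
    change m ≤ rc π S (- -w) at h5
    rw [neg_neg] at h4 h5
    exact ⟨h4, h5⟩

end phase2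

/-! ### Phase 1 -/

/-- The cop at relative position `(k, β)` is inside the good diamond. -/
def GoodRep (m : ℕ) (k β : ℤ) : Prop :=
  0 < k ∧ k < m ∧ β ≤ k ∧ -β ≤ k ∧ β ≤ m - k ∧ -β ≤ m - k

/-- Good states. -/
def Good (π : ℤ → ℤ → V) (m : ℕ) (c r : V) : Prop :=
  ∃ x y k β, r = π x y ∧ c = π (x + k) (y + β) ∧ GoodRep m k β

/-- The goal of phase 1. -/
def Goal1 (π : ℤ → ℤ → V) (n q E : ℕ) (c r : V) (S : Set V) : Prop :=
  c ≠ r ∧ r ∈ S ∧ Ex π n q E S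

section phase1

variable [Finite V] {G : SimpleGraph V} {m n q E : ℕ} {π : ℤ → ℤ → V} {S : Set V}
  {P : V → V → Prop}

theorem ex_flipy {S : Set V} (h : Ex π n q E S) : Ex (fun x y => π x (-y)) n q E S := by
  intro y0
  refine (h (-y0 - (n - q : ℕ) + 1)).trans (le_of_eq ?_)
  rw [← Finset.sum_range_reflect]
  refine Finset.sum_congr rfl fun i hi => ?_
  rw [Finset.mem_range] at hi
  rw [rc_flipy]
  congr 1
  omega

theorem flipy_flipy : (fun x y => (fun x y => π x (-y)) x (-y)) = π := by
  funext x y; simp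

theorem good_flipx (h : IsTorus G m n π) {c r : V} (hg : Good π m c r) :
    Good (fun x y => π (-x) y) m c r := by
  obtain ⟨x, y, k, β, rfl, rfl, hg⟩ := hg
  refine ⟨-x, y, m - k, β, by simp, ?_, by unfold GoodRep at *; omega⟩
  rw [h.eq_iff]
  refine ⟨?_, by simp⟩
  rw [show x + k - -(-x + (m - k)) = m by ring]

theorem good_flipy {c r : V} (hg : Good π m c r) :
    Good (fun x y => π x (-y)) m c r := by
  obtain ⟨x, y, k, β, rfl, rfl, hg⟩ := hg
  refine ⟨x, -y, k, -β, by simp, ?_, by unfold GoodRep at *; omega⟩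
  show _ = π _ (-(-y + -β))
  congr 1; ring

/-- A stuck family for the good game. -/
structure GStk (G : SimpleGraph V) (m n q E : ℕ) (π : ℤ → ℤ → V) (S : Set V)
    (P : V → V → Prop) : Prop where
  good : ∀ c r, P c r → Good π m c r
  mem : ∀ c r, P c r → r ∈ S
  nr : ∀ c r, P c r → ¬ Reach G (Goal1 π n q E) c r S
  cl : ∀ c r r', P c r → Nb G r r' → (∀ c', Nb G c c' → Good π m c' r') →
    ∃ c', Nb G c c' ∧ P c' r'

theorem GStk.flipx (hk : GStk G m n q E π S P) (h : IsTorus G m n π) :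
    GStk G m n q E (fun x y => π (-x) y) S P where
  good c r hP := good_flipx h (hk.good c r hP)
  mem := hk.mem
  nr c r hP hR := hk.nr c r hP (hR.bind fun c r S ⟨h1, h2, h3⟩ => Reach.done _ _ _ ⟨h1, h2, by
    intro y0
    simpa only [rc_flipx] using h3 y0⟩)
  cl c r r' hP hnb hall := hk.cl c r r' hP hnb fun c' hc' => by
    have := good_flipx h.flipx (hall c' hc')
    simpa using this

theorem GStk.flipy (hk : GStk G m n q E π S P) :
    GStk G m n q E (fun x y => π x (-y)) S P where
  good c r hP := good_flipy (hk.good c r hP)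
  mem := hk.mem
  nr c r hP hR := hk.nr c r hP (hR.bind fun c r S ⟨h1, h2, h3⟩ => Reach.done _ _ _ ⟨h1, h2, by
    have := ex_flipy h3
    simpa using this⟩)
  cl c r r' hP hnb hall := hk.cl c r r' hP hnb fun c' hc' => by
    have := good_flipy (hall c' hc')
    simpa using this

/-- Lifted good states. -/
def GSt (π : ℤ → ℤ → V) (m : ℕ) (P : V → V → Prop) (x y k β : ℤ) : Prop :=
  St π P x y k β ∧ GoodRep m k β

theorem gst_flipx (h : IsTorus G m n π) {x y k β : ℤ} (hs : GSt π m P x y k β) :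
    GSt (fun x y => π (-x) y) m P (-x) y (m - k) β := by
  refine ⟨?_, by have := hs.2; unfold GoodRep at *; omega⟩
  have := st_congr h hs.1 (x' := x) (y' := y) (k' := k - m) (β' := β) (by simp) (by simp) (by simp)
    (by simp)
  unfold St at *
  convert this using 2 <;> ring

theorem gst_flipx' (h : IsTorus G m n π) {x y k β : ℤ}
    (hs : GSt (fun x y => π (-x) y) m P x y k β) : GSt π m P (-x) y (m - k) β := by
  have := gst_flipx h.flipx hs
  simpa using this

theorem gst_flipy {x y k β : ℤ} (hs : GSt π m P x y k β) :
    GSt (fun x y => π x (-y)) m P x (-y) k (-β) := by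
  refine ⟨?_, by have := hs.2; unfold GoodRep at *; omega⟩
  have := hs.1
  unfold St at *
  convert this using 2 <;> ring

theorem gst_flipy' {x y k β : ℤ} (hs : GSt (fun x y => π x (-y)) m P x y k β) :
    GSt π m P x (-y) k (-β) := by
  have := gst_flipy hs
  simpa using this

theorem gst_of (hk : GStk G m n q E π S P) {c r : V} (hP : P c r) :
    ∃ x y k β, GSt π m P x y k β := by
  obtain ⟨x, y, k, β, rfl, rfl, hg⟩ := hk.good _ _ hP
  exact ⟨x, y, k, β, hP, hg⟩

theorem gst_norm (h : IsTorus G m n π) (hn : 0 < n) {x y k β : ℤ} (hs : GSt π m P x y k β) :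
    ∃ β', GSt π m P x y k β' ∧ 2 * β' ≤ n ∧ -(n : ℤ) ≤ 2 * β' := by
  obtain ⟨i, hi, hd⟩ := exists_rep n hn (-((n - 1) / 2 : ℕ)) β
  have hs' : St π P x y k (-((n - 1) / 2 : ℕ) + i) :=
    st_congr h hs.1 (by simp) (by simp) (by simp) hd
  obtain ⟨γ, hγ⟩ : ∃ γ : ℤ, γ = -((n - 1) / 2 : ℕ) + i := ⟨_, rfl⟩
  rw [← hγ] at hd hs'
  have h2 := hs.2
  refine ⟨γ, ⟨hs', ?_⟩, by omega, by omega⟩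
  by_cases hb : -(n : ℤ) < 2 * β ∧ 2 * β < n
  · have := dvd_small hd (by omega) (by omega)
    obtain rfl : γ = β := by omega
    exact h2
  · unfold GoodRep at *; omega

theorem gmove (h : IsTorus G m n π) (hk : GStk G m n q E π S P) {x y k β a b : ℤ}
    (hs : GSt π m P x y k β) (hab : L1 a b 1)
    (hf : ∀ a' b', L1 a' b' 1 → GoodRep m (k + a' - a) (β + b' - b)) :
    ∃ k' β', L1 (k' - k + a) (β' - β + b) 1 ∧ GSt π m P (x + a) (y + b) k' β' := by
  obtain ⟨c', hc', hP⟩ := hk.cl _ _ (π (x + a) (y + b)) hs.1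
    ((h.nb _ _ _).2 ⟨a, b, hab, rfl⟩) (by
      intro c' hc'
      obtain ⟨a', b', hab', rfl⟩ := (h.nb _ _ _).1 hc'
      refine ⟨x + a, y + b, k + a' - a, β + b' - b, rfl, ?_, hf a' b' hab'⟩
      congr 1 <;> ring)
  obtain ⟨a', b', hab', rfl⟩ := (h.nb _ _ _).1 hc'
  refine ⟨k + a' - a, β + b' - b, ?_, ?_, hf a' b' hab'⟩
  · unfold L1 at *; omega
  · unfold St
    convert hP using 2 <;> ring

/-- Moving right in the good game. -/
theorem gmove_right (h : IsTorus G m n π) (hk : GStk G m n q E π S P) {x y k β : ℤ}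
    (hs : GSt π m P x y k β) (h1 : 3 ≤ k) (h2 : β + 2 ≤ k) (h3 : -β + 2 ≤ k) :
    ∃ k' β', L1 (k' - k + 1) (β' - β) 1 ∧ GSt π m P (x + 1) y k' β' := by
  have := gmove h hk hs (a := 1) (b := 0) (by unfold L1; omega) (by
    intro a' b' hab
    have := hs.2
    unfold GoodRep L1 at *; omega)
  simpa using this

/-- Moving up in the good game. -/
theorem gmove_up (h : IsTorus G m n π) (hk : GStk G m n q E π S P) {x y k β : ℤ}
    (hs : GSt π m P x y k β) (h1 : 2 ≤ k) (h2 : k ≤ m - 2) (h3 : 0 ≤ β) :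
    ∃ k' β', L1 (k' - k) (β' - β + 1) 1 ∧ GSt π m P x (y + 1) k' β' := by
  have := gmove h hk hs (a := 0) (b := 1) (by unfold L1; omega) (by
    intro a' b' hab
    have := hs.2
    unfold GoodRep L1 at *; omega)
  simpa using this

theorem grun_i (h : IsTorus G m n π) (hk : GStk G m n q E π S P) {x y k β : ℤ}
    (hs : GSt π m P x y k β) (hb1 : β ≤ 1) (hb2 : -1 ≤ β) :
    ∃ d : ℕ, (∀ i : ℤ, 0 ≤ i → i ≤ d → π (x + i) y ∈ S) ∧ k ≤ 2 * d + 2 := by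
  by_contra hcon
  push Not at hcon
  have main : ∀ j : ℕ, (∀ i : ℤ, 0 ≤ i → i ≤ j → π (x + i) y ∈ S) ∧
      ∃ k' β', (k - k') + (β' - β) ≤ 2 * j ∧ (k - k') - (β' - β) ≤ 2 * j ∧
        GSt π m P (x + j) y k' β' := by
    intro j
    induction j with
    | zero =>
      refine ⟨?_, k, β, by simp, by simp, by simpa using hs⟩
      intro i h1 h2
      obtain rfl : i = 0 := by simp at h2; omega
      simpa using hk.mem _ _ hs.1
    | succ j ih =>
      obtain ⟨ih1, k', β', hl, hl', hst⟩ := ih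
      have hc := hcon j ih1
      obtain ⟨k2, β2, hl2, hst2⟩ := gmove_right h hk hst (by omega) (by omega) (by omega)
      have hst3 : GSt π m P (x + (j + 1 : ℕ)) y k2 β2 := by
        convert hst2 using 1; push_cast; ring
      unfold L1 at hl2
      refine ⟨?_, k2, β2, by push_cast; omega, by push_cast; omega, hst3⟩
      intro i h1 h2
      by_cases hi : i ≤ j
      · exact ih1 i h1 hi
      · obtain rfl : i = (j + 1 : ℕ) := by omega
        exact hk.mem _ _ hst3.1
  have := hcon m (main m).1
  have := hs.2
  unfold GoodRep at this
  omega

theorem grun_ii (h : IsTorus G m n π) (hn : 4 ≤ n) (hk : GStk G m n q E π S P) {x y k β : ℤ}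
    (hs : GSt π m P x y k β) :
    ∃ d : ℕ, (∀ i : ℤ, 0 ≤ i → i ≤ d → π (x + i) y ∈ S) ∧ k ≤ (n / 2 : ℕ) + 1 + 2 * d := by
  by_contra hcon
  push Not at hcon
  have main : ∀ j : ℕ, (∀ i : ℤ, 0 ≤ i → i ≤ j → π (x + i) y ∈ S) ∧
      ∃ k' β', k - k' ≤ 2 * j ∧ GSt π m P (x + j) y k' β' := by
    intro j
    induction j with
    | zero =>
      refine ⟨?_, k, β, by simp, by simpa using hs⟩
      intro i h1 h2
      obtain rfl : i = 0 := by simp at h2; omega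
      simpa using hk.mem _ _ hs.1
    | succ j ih =>
      obtain ⟨ih1, k', β0, hl, hst⟩ := ih
      obtain ⟨β', hst, hb1, hb2⟩ := gst_norm h (by omega) hst
      have hc := hcon j ih1
      obtain ⟨k2, β2, hl2, hst2⟩ := gmove_right h hk hst (by omega) (by omega) (by omega)
      have hst3 : GSt π m P (x + (j + 1 : ℕ)) y k2 β2 := by
        convert hst2 using 1; push_cast; ring
      unfold L1 at hl2
      refine ⟨?_, k2, β2, by push_cast; omega, hst3⟩
      intro i h1 h2
      by_cases hi : i ≤ j
      · exact ih1 i h1 hi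
      · obtain rfl : i = (j + 1 : ℕ) := by omega
        exact hk.mem _ _ hst3.1
  have := hcon m (main m).1
  have := hs.2
  unfold GoodRep at this
  omega

theorem seg_combine (h : IsTorus G m n π) {x y : ℤ} {d d' t : ℕ}
    (h1 : ∀ i : ℤ, 0 ≤ i → i ≤ d → π (x + i) y ∈ S)
    (h2 : ∀ i : ℤ, 0 ≤ i → i ≤ d' → (fun x y => π (-x) y) (-x + i) y ∈ S)
    (ht : t ≤ d + d' + 1) (hm : t ≤ m) : t ≤ rc π S y := by
  refine rc_seg h (x := x) (d := d) (d' := d') ?_ ht hm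
  intro i h5 h6
  rcases le_total 0 i with hi0 | hi0
  · exact h1 i hi0 h6
  · have := h2 (-i) (by omega) (by omega)
    simp only at this
    rwa [show -(-x + -i) = x + i by ring] at this

theorem grow_p (h : IsTorus G m n π) (hk : GStk G m n q E π S P) {x y k β : ℤ}
    (hs : GSt π m P x y k β) (hb1 : β ≤ 1) (hb2 : -1 ≤ β) : (m - 1) / 2 ≤ rc π S y := by
  obtain ⟨d, h1, h2⟩ := grun_i h hk hs hb1 hb2
  obtain ⟨d', h3, h4⟩ := grun_i h.flipx (hk.flipx h) (gst_flipx h hs) hb1 hb2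
  exact seg_combine h h1 h3 (by omega) (by omega)

theorem grow_e (h : IsTorus G m n π) (hn : 4 ≤ n) (hk : GStk G m n q E π S P) {x y k β : ℤ}
    (hs : GSt π m P x y k β) {e : ℕ} (he : e ≤ 1 ∨ 2 * e + 2 * (n / 2) ≤ m + 1) :
    e ≤ rc π S y := by
  obtain ⟨d, h1, h2⟩ := grun_ii h hn hk hs
  obtain ⟨d', h3, h4⟩ := grun_ii h.flipx hn (hk.flipx h) (gst_flipx h hs)
  have := hs.2
  unfold GoodRep at this
  exact seg_combine h h1 h3 (by omega) (by omega)

end phase1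

section away

variable [Finite V] {G : SimpleGraph V} {m n q E : ℕ} {π : ℤ → ℤ → V} {S : Set V}
  {P : V → V → Prop}

theorem window_two (S : Set V) (y0 : ℤ) {i j k : ℕ} (hi : i < k) (hj : j < k) (hij : i ≠ j) :
    rc π S (y0 + i) + rc π S (y0 + j) ≤ ∑ i ∈ Finset.range k, rc π S (y0 + i) := by
  rw [← Finset.sum_pair (f := fun i : ℕ => rc π S (y0 + i)) hij]
  refine Finset.sum_le_sum_of_subset ?_
  intro a ha
  simp only [Finset.mem_insert, Finset.mem_singleton] at ha
  rw [Finset.mem_range]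
  omega

theorem window_one (S : Set V) (y0 : ℤ) {i k : ℕ} (hi : i < k) :
    rc π S (y0 + i) ≤ ∑ i ∈ Finset.range k, rc π S (y0 + i) :=
  Finset.single_le_sum (f := fun i : ℕ => rc π S (y0 + i)) (fun _ _ => Nat.zero_le _)
    (Finset.mem_range.2 hi)

theorem ex_of (h : IsTorus G m n π) {w : ℤ} (hq : 1 ≤ q)
    (h1 : E ≤ rc π S w + rc π S (w + 1))
    (h2 : (n = 2 * q + 1 ∧ E ≤ rc π S (w - q)) ∨
      (n = 2 * q + 2 ∧ E ≤ rc π S (w - q) + rc π S (w - q - 1))) : Ex π n q E S := by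
  intro y0
  obtain ⟨i, hi, hd⟩ := exists_rep n (by omega) y0 w
  have key : ∀ (δ : ℤ) (j : ℕ), (j : ℤ) = i + δ → rc π S (w + δ) = rc π S (y0 + j) := by
    intro δ j hj
    apply rc_congr h
    rwa [hj, show w + δ - (y0 + (i + δ)) = w - (y0 + i) by ring]
  by_cases hw : i + 1 < n - q
  · have e1 := key 0 i (by simp)
    have e2 := key 1 (i + 1) (by push_cast; rfl)
    have := window_two (π := π) S y0 (show i < n - q by omega) hw (by omega)
    rw [add_zero] at e1
    rw [← e1, ← e2] at this
    omega
  · have e1 := key (-q) (i - q) (by omega)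
    rw [← sub_eq_add_neg] at e1
    rcases h2 with ⟨hn, h2⟩ | ⟨hn, h2⟩
    · have := window_one (π := π) S y0 (show i - q < n - q by omega)
      rw [← e1] at this
      omega
    · have e2 := key (-q - 1) (i - q - 1) (by omega)
      rw [show w + (-(q : ℤ) - 1) = w - q - 1 by ring] at e2
      have := window_two (π := π) S y0 (show i - q < n - q by omega)
        (show i - q - 1 < n - q by omega) (by omega)
      rw [← e1, ← e2] at this
      omega

theorem down_reach (h : IsTorus G m n π) (hq : 2 * q + 1 ≤ n) {x w k β : ℤ} (hg : GoodRep m k β)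
    (hb0 : 0 ≤ β) (hbn : 2 * β ≤ n) (S0 : Set V) : ∀ t j : ℕ, j + t = q →
    ∀ (k' β' : ℤ) (S : Set V), L1 (k' - k) (β' - β - j) j → S0 ⊆ S → π x (w - j) ∈ S →
      π (x + k') (w - j + β') ≠ π x (w - j) →
      Reach G (fun c r S => c ≠ r ∧ r ∈ S ∧ S0 ⊆ S ∧ r ∈ trow π (w - q))
        (π (x + k') (w - j + β')) (π x (w - j)) S := by
  intro t
  induction t with
  | zero =>
    intro j hj k' β' S _ hS hr hne
    refine Reach.done _ _ _ ⟨hne, hr, hS, x, ?_⟩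
    rw [← hj]; simp
  | succ t ih =>
    intro j hj k' β' S hl hS hr hne
    have hcap : ∀ c', Nb G (π (x + k') (w - j + β')) c' → c' ≠ π x (w - (j + 1 : ℕ)) := by
      intro c' hc' e
      obtain ⟨a', b', hab, rfl⟩ := (h.nb _ _ _).1 hc'
      rw [h.eq_iff] at e
      obtain ⟨e1, e2⟩ := e
      rw [show x + k' + a' - x = k' + a' by ring] at e1
      rw [show w - j + β' + b' - (w - (j + 1 : ℕ)) = β' + b' + 1 by push_cast; ring] at e2
      have e2' : (n : ℤ) ∣ β' + b' + 1 - n := by simpa using e2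
      unfold L1 GoodRep at *
      have hk0 : k' + a' ≤ 0 ∨ m ≤ k' + a' := by
        by_contra hcon
        have := dvd_small e1 (by omega) (by omega)
        omega
      by_cases hc : β' + b' + 1 < n
      · have := dvd_small e2 (by omega) hc
        omega
      · have := dvd_small e2' (by omega) (by omega)
        omega
    refine Reach.step _ _ _ (π x (w - (j + 1 : ℕ))) (h.nb_mk ?_) hcap ?_
    · unfold L1; push_cast; omega
    · intro c' hc'
      have hne' := hcap c' hc'
      obtain ⟨a', b', hab, rfl⟩ := (h.nb _ _ _).1 hc'
      have e : π (x + k' + a') (w - j + β' + b') =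
          π (x + (k' + a')) (w - (j + 1 : ℕ) + (β' + b' + 1)) := by
        congr 1 <;> push_cast <;> ring
      rw [e] at hne' ⊢
      refine ih (j + 1) (by omega) _ _ _ ?_ (hS.trans (Set.subset_insert _ _))
        (Set.mem_insert _ _) hne'
      unfold L1 at *; push_cast; omega

theorem away (h : IsTorus G m n π) (hm : 5 ≤ m) (hn : 4 ≤ n)
    (hq : n = 2 * q + 1 ∧ E ≤ (m - 1) / 2 ∨ n = 2 * q + 2 ∧ E ≤ 2 * ((m - 1) / 2)) {x w k β : ℤ}
    (hg : GoodRep m k β) (hb0 : 0 ≤ β) (hbn : 2 * β ≤ n) {S : Set V}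
    (hr : π x w ∈ S) (hE : E ≤ rc π S w + rc π S (w + 1)) :
    Reach G (Goal1 π n q E) (π (x + k) (w + β)) (π x w) S := by
  have hne : π (x + k) (w + β) ≠ π x w := by
    unfold GoodRep at hg
    exact h.ne_of_x (by omega) (by omega) (by omega)
  have h0 := down_reach h (q := q) (by omega) (x := x) (w := w) hg hb0 hbn S q 0 (by simp) k β S
    (by unfold L1; simp) subset_rfl (by simpa using hr) (by simpa using hne)
  simp only [Nat.cast_zero, sub_zero] at h0
  refine h0.bind ?_
  rintro c1 r1 S1 ⟨a1, a2, a3, a4⟩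
  refine (row_reach h (by omega) a1 a2 a4).bind ?_
  rintro c2 r2 S2 ⟨b1, b2, b3, b4, b5⟩
  have hE2 : ∀ S', S2 ⊆ S' → E ≤ rc π S' w + rc π S' (w + 1) ∧ (m - 1) / 2 ≤ rc π S' (w - q) := by
    intro S' hS'
    have i1 := rc_mono (π := π) ((a3.trans b3).trans hS') w
    have i2 := rc_mono (π := π) ((a3.trans b3).trans hS') (w + 1)
    have i3 := rc_mono (π := π) hS' (w - q)
    omega
  rcases hq with ⟨hq, hE1⟩ | ⟨hq, hE1⟩
  · have := hE2 S2 subset_rfl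
    refine Reach.done _ _ _ ⟨b1, b2, ex_of h (w := w) (by omega) this.1 (Or.inl ⟨hq, by omega⟩)⟩
  · refine (descend_reach h hm hn b1 b2 b4).bind ?_
    rintro c3 r3 S3 ⟨d1, d2, d3, d4 | ⟨d4, d5⟩⟩
    · refine (row_reach h (by omega) d1 d2 d4).bind ?_
      rintro c4 r4 S4 ⟨f1, f2, f3, f4, f5⟩
      have := hE2 S4 (d3.trans f3)
      exact Reach.done _ _ _ ⟨f1, f2, ex_of h (w := w) (by omega) this.1 (Or.inr ⟨hq, by omega⟩)⟩
    · have := hE2 S3 d3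
      exact Reach.done _ _ _ ⟨d1, d2, ex_of h (w := w) (by omega) this.1 (Or.inr ⟨hq, by omega⟩)⟩

/-- Arithmetic relations between the parameters of phase 1. -/
structure Par (m n q E e : ℕ) : Prop where
  hm : 5 ≤ m
  hn : 4 ≤ n
  hq : n = 2 * q + 1 ∧ E ≤ (m - 1) / 2 ∨ n = 2 * q + 2 ∧ E ≤ 2 * ((m - 1) / 2)
  he : e ≤ 1 ∨ 2 * e + 2 * (n / 2) ≤ m + 1
  h1 : E ≤ (m - 1) / 2 + e
  h2 : E ≤ (n - q) * e

variable {e : ℕ}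

theorem gaway (hp : Par m n q E e) (h : IsTorus G m n π) (hk : GStk G m n q E π S P) {x y k β : ℤ}
    (hs : GSt π m P x y k β) (hb0 : 0 ≤ β) (hbn : 2 * β ≤ n) :
    rc π S y + rc π S (y + 1) < E := by
  by_contra hcon
  exact hk.nr _ _ hs.1 (away h hp.hm hp.hn hp.hq hs.2 hb0 hbn (hk.mem _ _ hs.1) (by omega))

theorem not_full (hp : Par m n q E e) (h : IsTorus G m n π) (hk : GStk G m n q E π S P)
    {x y k β : ℤ} (hs : GSt π m P x y k β) : ¬ ∀ x, π x y ∈ S := by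
  intro hf
  have h0 := rc_full h hf
  have := hp.hm
  have := hp.hn
  have := hp.hq
  obtain ⟨β', hs', b1, b2⟩ := gst_norm h (by omega) hs
  rcases le_total 0 β' with hb | hb
  · have := gaway hp h hk hs' hb b1
    omega
  · have := gaway hp h.flipy hk.flipy (gst_flipy hs') (by omega) (by omega)
    rw [rc_flipy, neg_neg] at this
    omega

theorem caseB1 (hp : Par m n q E e) (h : IsTorus G m n π) (hk : GStk G m n q E π S P)
    {x y k β : ℤ} (hs : GSt π m P x y k β) (hb0 : 0 ≤ β) (hbn : 2 * β ≤ n) (h1 : 2 ≤ k)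
    (h2 : k ≤ m - 2) (hr : (m - 1) / 2 ≤ rc π S y) : False := by
  have ha := gaway hp h hk hs hb0 hbn
  obtain ⟨k', β', -, hs'⟩ := gmove_up h hk hs h1 h2 hb0
  have := grow_e h hp.hn hk hs' hp.he
  have := hp.h1
  omega

theorem caseB2 (hp : Par m n q E e) (h : IsTorus G m n π) (hk : GStk G m n q E π S P)
    {x y k β : ℤ} (hs : GSt π m P x y k β) (h1 : 2 ≤ k)
    (h2 : k ≤ m - 2) (hr : (m - 1) / 2 ≤ rc π S y) : False := by
  have := hp.hn
  obtain ⟨β', hs', b1, b2⟩ := gst_norm h (by omega) hs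
  rcases le_total 0 β' with hb | hb
  · exact caseB1 hp h hk hs' hb b1 h1 h2 hr
  · refine caseB1 hp h.flipy hk.flipy (gst_flipy hs') (by omega) (by omega) h1 h2 ?_
    rwa [rc_flipy, neg_neg]

theorem caseB3 (hp : Par m n q E e) (h : IsTorus G m n π) (hk : GStk G m n q E π S P)
    {x y k β : ℤ} (hs : GSt π m P x y k β) (hkk : k = m - 1)
    (hr : (m - 1) / 2 ≤ rc π S y) : False := by
  have hm := hp.hm
  have main : ∀ j : ℕ, ∃ β', GSt π m P (x + j) y (m - 1) β' := by
    intro j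
    induction j with
    | zero => exact ⟨β, by rw [← hkk]; simpa using hs⟩
    | succ j ih =>
      obtain ⟨β', hs'⟩ := ih
      have hg := hs'.2
      unfold GoodRep at hg
      obtain ⟨k2, β2, hl, hs2⟩ := gmove_right h hk hs' (by omega) (by omega) (by omega)
      unfold L1 at hl
      have hg2 := hs2.2
      unfold GoodRep at hg2
      by_cases hc : k2 ≤ m - 2
      · exact (caseB2 hp h hk hs2 (by omega) hc hr).elim
      · obtain rfl : k2 = m - 1 := by omega
        refine ⟨β2, ?_⟩
        convert hs2 using 1; push_cast; ring
  apply not_full hp h hk hs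
  intro x'
  obtain ⟨i, _, hd⟩ := exists_rep m (by omega) x x'
  obtain ⟨β', h1⟩ := main i
  have h2 := hk.mem _ _ h1.1
  rwa [(h.eq_iff x' y (x + i) y).2 ⟨hd, by simp⟩]

theorem caseB (hp : Par m n q E e) (h : IsTorus G m n π) (hk : GStk G m n q E π S P)
    {x y k β : ℤ} (hs : GSt π m P x y k β) (hb1 : β ≤ 1) (hb2 : -1 ≤ β) : False := by
  have hr := grow_p h hk hs hb1 hb2
  have hg := hs.2
  unfold GoodRep at hg
  by_cases h1 : k = m - 1
  · exact caseB3 hp h hk hs h1 hr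
  · by_cases h2 : k = 1
    · refine caseB3 hp h.flipx (hk.flipx h) (gst_flipx h hs) (by rw [h2]) ?_
      rwa [rc_flipx]
    · exact caseB2 hp h hk hs (by omega) (by omega) hr

theorem caseA (hp : Par m n q E e) (h : IsTorus G m n π) (hk : GStk G m n q E π S P)
    {x y k β : ℤ} (hs : GSt π m P x y k β) (hb : 2 ≤ β) : False := by
  have hn := hp.hn
  have main : ∀ j : ℕ, ∃ k' β', GSt π m P x (y + j) k' β' ∧ 2 ≤ β' := by
    intro j
    induction j with
    | zero => exact ⟨k, β, by simpa using hs, hb⟩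
    | succ j ih =>
      obtain ⟨k', β', hs', hb'⟩ := ih
      have hg := hs'.2
      unfold GoodRep at hg
      obtain ⟨k2, β2, hl, hs2⟩ := gmove_up h hk hs' (by omega) (by omega) (by omega)
      unfold L1 at hl
      by_cases hc : β2 ≤ 1
      · exact (caseB hp h hk hs2 hc (by omega)).elim
      · refine ⟨k2, β2, ?_, by omega⟩
        convert hs2 using 1; push_cast; ring
  have hall : ∀ y', e ≤ rc π S y' := by
    intro y'
    obtain ⟨i, _, hd⟩ := exists_rep n (by omega) y y'
    obtain ⟨k', β', h1, _⟩ := main i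
    rw [rc_congr h S hd]
    exact grow_e h hn hk h1 hp.he
  refine hk.nr _ _ hs.1 (Reach.done _ _ _ ⟨?_, hk.mem _ _ hs.1, ?_⟩)
  · have hg := hs.2
    unfold GoodRep at hg
    exact h.ne_of_x (by omega) (by omega) (by omega)
  · intro y0
    refine hp.h2.trans ?_
    calc (n - q) * e = ∑ i ∈ Finset.range (n - q), e := by simp
      _ ≤ _ := Finset.sum_le_sum fun i _ => hall _

theorem phase1 (hp : Par m n q E e) (h : IsTorus G m n π) {c r : V} {S0 : Set V}
    (hg : Good π m c r) (hr : r ∈ S0) : Reach G (Goal1 π n q E) c r S0 := by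
  by_contra hcon
  obtain ⟨S, P, h1, ⟨c1, r1, hP⟩, h3, h4⟩ := stuck (G := G) (Good π m) hg hr hcon
  have hk : GStk G m n q E π S P := by
    refine ⟨fun c r hP => (h3 c r hP).1, fun c r hP => (h3 c r hP).2.1,
      fun c r hP => (h3 c r hP).2.2, ?_⟩
    intro c r r' hP hnb hall
    refine h4 c r r' hP hnb fun c' hc' => ⟨?_, hall c' hc'⟩
    obtain ⟨x, y, k, β, rfl, rfl, hg⟩ := hall c' hc'
    unfold GoodRep at hg
    exact h.ne_of_x (by omega) (by omega) (by omega)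
  obtain ⟨x, y, k, β, hs⟩ := gst_of hk hP
  by_cases hb1 : 2 ≤ β
  · exact caseA hp h hk hs hb1
  · by_cases hb2 : β ≤ -2
    · exact caseA hp h.flipy hk.flipy (gst_flipy hs) (by omega)
    · exact caseB hp h hk hs (by omega) (by omega)

theorem exists_par (hm : 5 ≤ m) (hn : 4 ≤ n) :
    ∃ e, Par m n ((n - 1) / 2) ((m - 1) / 2 * n - (n - 1) / 2 * m) e := by
  obtain ⟨p, hp⟩ : ∃ p, p = (m - 1) / 2 := ⟨_, rfl⟩
  obtain ⟨q, hq⟩ : ∃ q, q = (n - 1) / 2 := ⟨_, rfl⟩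
  rw [← hp, ← hq]
  have hm' : m = 2 * p + 1 ∨ m = 2 * p + 2 := by omega
  have hqm : q * (2 * p + 1) ≤ q * m := Nat.mul_le_mul_left _ (by omega)
  have hE : n = 2 * q + 1 ∧ p * n - q * m ≤ p - q ∨
      n = 2 * q + 2 ∧ p * n - q * m ≤ 2 * p - q := by
    rcases (show n = 2 * q + 1 ∨ n = 2 * q + 2 by omega) with h | h
    · left
      refine ⟨h, ?_⟩
      have : p * n = 2 * (p * q) + p := by rw [h]; ring
      have : q * (2 * p + 1) = 2 * (p * q) + q := by ring
      omega
    · right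
      refine ⟨h, ?_⟩
      have : p * n = 2 * (p * q) + 2 * p := by rw [h]; ring
      have : q * (2 * p + 1) = 2 * (p * q) + q := by ring
      omega
  obtain ⟨E, hEE⟩ : ∃ E, E = p * n - q * m := ⟨_, rfl⟩
  rw [← hEE] at hE ⊢
  rcases hE with ⟨h1, h2⟩ | ⟨h1, h2⟩
  · refine ⟨max 1 (p + 1 - q), hm, hn, by omega, by omega, by omega, ?_⟩
    calc E ≤ 1 * max 1 (p + 1 - q) := by omega
      _ ≤ _ := Nat.mul_le_mul_right _ (by omega)
  · refine ⟨max 1 (p - q), hm, hn, by omega, by omega, by omega, ?_⟩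
    rw [show n - q = q + 2 by omega]
    rcases le_or_gt p q with hpq | hpq
    · rw [show max 1 (p - q) = 1 by omega]
      omega
    · rw [show max 1 (p - q) = p - q by omega]
      obtain ⟨s, rfl⟩ : ∃ s, p = q + 1 + s := ⟨p - q - 1, by omega⟩
      rw [show q + 1 + s - q = s + 1 by omega]
      have : (q + 2) * (s + 1) = q * s + 2 * s + q + 2 := by ring
      have := Nat.zero_le (q * s)
      omega

theorem torus_lower (h : IsTorus G m n π) (hm : 5 ≤ m) (hn : 4 ≤ n) :
    (m - 1) / 2 * n ≤ dmg G := by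
  obtain ⟨e, hp⟩ := exists_par hm hn
  have : Nonempty V := ⟨π 0 0⟩
  refine le_dmg_of_reach (Goal := fun _ _ S => (m - 1) / 2 * n ≤ S.ncard) (fun _ _ _ h => h) ?_
  intro c0
  obtain ⟨x0, y0, rfl⟩ := h.surj c0
  refine ⟨π (x0 - 2) y0, fun c1 hc1 => ?_⟩
  obtain ⟨a, b, hab, rfl⟩ := (h.nb _ _ _).1 hc1
  unfold L1 at hab
  refine ⟨h.ne_of_x (by omega) (by omega) (by omega), ?_⟩
  refine (phase1 hp h (c := π (x0 + a) (y0 + b)) ⟨x0 - 2, y0, 2 + a, b, rfl, ?_, ?_⟩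
    (Set.mem_singleton _)).bind ?_
  · congr 1; ring
  · unfold GoodRep; omega
  · rintro c r S ⟨h1, h2, h3⟩
    exact phase2 h hm hn h1 h2 h3

end away

/-! ### Cycles and the final theorem -/

/-- The covering of the cycle by `ℤ`. -/
def cyc (k : ℕ) (hk : 0 < k) (x : ℤ) : Fin k :=
  ⟨(x % k).toNat, by
    have := Int.emod_lt_of_pos x (show (0 : ℤ) < k by omega)
    have := Int.emod_nonneg x (show (k : ℤ) ≠ 0 by omega)
    omega⟩

theorem cyc_val (k : ℕ) (hk : 0 < k) (x : ℤ) : ((cyc k hk x).val : ℤ) = x % k := by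
  have := Int.emod_nonneg x (show (k : ℤ) ≠ 0 by omega)
  simp only [cyc]
  omega

theorem cyc_eq_iff (k : ℕ) (hk : 0 < k) (x y : ℤ) :
    cyc k hk x = cyc k hk y ↔ (k : ℤ) ∣ x - y := by
  rw [Fin.ext_iff, ← Int.natCast_inj, cyc_val, cyc_val]
  exact Int.emod_eq_emod_iff_emod_sub_eq_zero.trans (Int.dvd_iff_emod_eq_zero).symm

theorem cyc_surj (k : ℕ) (hk : 0 < k) (v : Fin k) : v = cyc k hk v.val := by
  rw [Fin.ext_iff, ← Int.natCast_inj, cyc_val, Int.emod_eq_of_lt (by omega) (by omega)]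

theorem cyc_sub (k : ℕ) (hk : 2 ≤ k) (x y : ℤ) :
    (cyc k (by omega) x - cyc k (by omega) y).val = 1 ↔ (k : ℤ) ∣ x - y - 1 := by
  have hx := cyc_val k (by omega) x
  have hy := cyc_val k (by omega) y
  generalize cyc k (by omega) x = u at *
  generalize cyc k (by omega) y = v at *
  rw [← Int.natCast_inj, Fin.val_sub]
  push_cast [Nat.cast_sub v.isLt.le]
  rw [hx, hy]
  have h1 : ((1 : ℤ)) = 1 % k := by rw [Int.emod_eq_of_lt (by omega) (by omega)]
  conv_lhs => rw [h1]
  rw [← Int.ModEq, Int.modEq_comm, Int.modEq_iff_dvd]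
  have hx' := Int.mul_ediv_add_emod x k
  have hy' := Int.mul_ediv_add_emod y k
  have e : (k : ℤ) - y % k + x % k - 1 = (x - y - 1) + k * (1 + y / k - x / k) := by
    linear_combination hx' - hy'
  rw [e, dvd_add_left (dvd_mul_right _ _)]

theorem cyc_adj (k : ℕ) (hk : 2 ≤ k) (x y : ℤ) :
    (cycleGraph k).Adj (cyc k (by omega) x) (cyc k (by omega) y) ↔
      cyc k (by omega) y = cyc k (by omega) (x + 1) ∨
      cyc k (by omega) y = cyc k (by omega) (x - 1) := by
  rw [cycleGraph_adj', cyc_sub k hk, cyc_sub k hk, cyc_eq_iff, cyc_eq_iff, or_comm,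
    show y - x - 1 = y - (x + 1) by ring, ← dvd_neg (b := x - y - 1),
    show -(x - y - 1) = y - (x - 1) by ring]

theorem torus_cycle (k : ℕ) (hk : 2 ≤ k) :
    IsTorus (cycleGraph k) k 1 (fun x _ => cyc k (by omega) x) where
  eq_iff x y x' y' := by
    rw [cyc_eq_iff]; simp
  surj v := ⟨v.val, 0, cyc_surj _ _ _⟩
  nb x y v := by
    obtain ⟨z, rfl⟩ : ∃ z, v = cyc k (by omega) z := ⟨_, cyc_surj _ _ _⟩
    unfold Nb
    rw [cyc_adj k hk]
    constructor
    · rintro (e | e | e)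
      · exact ⟨0, 0, by unfold L1; omega, by simpa using e⟩
      · exact ⟨1, 0, by unfold L1; omega, e⟩
      · exact ⟨-1, 0, by unfold L1; omega, e⟩
    · rintro ⟨a, b, hab, e⟩
      unfold L1 at hab
      rcases (show a = 0 ∨ a = 1 ∨ a = -1 by omega) with rfl | rfl | rfl
      · left; simpa using e
      · right; left; exact e
      · right; right; exact e

theorem torus_prod (m n : ℕ) (hm : 2 ≤ m) (hn : 2 ≤ n) :
    IsTorus (cycleGraph m □ cycleGraph n) m n
      (fun x y => (cyc m (by omega) x, cyc n (by omega) y)) where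
  eq_iff x y x' y' := by
    rw [Prod.mk.injEq, cyc_eq_iff, cyc_eq_iff]
  surj v := ⟨v.1.val, v.2.val, by rw [← cyc_surj, ← cyc_surj]⟩
  nb x y v := by
    obtain ⟨v1, v2⟩ := v
    obtain ⟨z, rfl⟩ : ∃ z, v1 = cyc m (by omega) z := ⟨_, cyc_surj _ _ _⟩
    obtain ⟨w, rfl⟩ : ∃ z, v2 = cyc n (by omega) z := ⟨_, cyc_surj _ _ _⟩
    unfold Nb
    rw [boxProd_adj, cyc_adj m hm, cyc_adj n hn]
    simp only [Prod.mk.injEq]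
    constructor
    · rintro (⟨e, f⟩ | ⟨e | e, f⟩ | ⟨e | e, f⟩)
      · exact ⟨0, 0, by unfold L1; omega, by simpa using e, by simpa using f⟩
      · exact ⟨1, 0, by unfold L1; omega, e, by simpa using f.symm⟩
      · exact ⟨-1, 0, by unfold L1; omega, e, by simpa using f.symm⟩
      · exact ⟨0, 1, by unfold L1; omega, by simpa using f.symm, e⟩
      · exact ⟨0, -1, by unfold L1; omega, by simpa using f.symm, e⟩
    · rintro ⟨a, b, hab, e, f⟩
      unfold L1 at hab
      rcases (show (a = 0 ∧ b = 0) ∨ (a = 1 ∧ b = 0) ∨ (a = -1 ∧ b = 0) ∨ (a = 0 ∧ b = 1) ∨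
        (a = 0 ∧ b = -1) by omega) with ⟨rfl, rfl⟩ | ⟨rfl, rfl⟩ | ⟨rfl, rfl⟩ | ⟨rfl, rfl⟩ | ⟨rfl, rfl⟩
      · left; exact ⟨by simpa using e, by simpa using f⟩
      · right; left; exact ⟨Or.inl e, by simpa using f.symm⟩
      · right; left; exact ⟨Or.inr e, by simpa using f.symm⟩
      · right; right; exact ⟨Or.inl f, by simpa using e.symm⟩
      · right; right; exact ⟨Or.inr f, by simpa using e.symm⟩

theorem dmg_cycle (k : ℕ) (hk : 4 ≤ k) : dmg (cycleGraph k) = (k - 1) / 2 := by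
  have h := torus_cycle k (by omega)
  apply le_antisymm
  · have := torus_upper h.swap (by omega) rfl
    simpa using this
  · have : Nonempty (Fin k) := ⟨⟨0, by omega⟩⟩
    refine le_dmg_of_reach (Goal := fun _ _ S => (k - 1) / 2 ≤ S.ncard) (fun _ _ _ h => h) ?_
    intro c0
    obtain ⟨x0, y0, rfl⟩ := h.surj c0
    refine ⟨cyc k (by omega) (x0 - 2), fun c1 hc1 => ?_⟩
    obtain ⟨a, b, hab, rfl⟩ := (h.nb x0 0 _).1 hc1
    unfold L1 at hab
    have hne := h.ne_of_x (x := x0 + a) (x' := x0 - 2) (y := 0) (y' := 0) (by omega) (by omega)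
      (by omega)
    refine ⟨hne, (row_reach h (w := 0) (by omega) hne (Set.mem_singleton _) ⟨_, rfl⟩).bind ?_⟩
    rintro c r S ⟨-, -, -, -, h5⟩
    exact Reach.done _ _ _ (h5.trans (Set.ncard_le_ncard Set.inter_subset_left (Set.toFinite _)))

theorem dmg_torus {m n : ℕ} (hm : 4 ≤ m) (hn : 4 ≤ n) (hodd : Odd m ∨ Odd n) :
    dmg (cycleGraph m □ cycleGraph n) = max ((m - 1) / 2 * n) ((n - 1) / 2 * m) := by
  have h := torus_prod m n (by omega) (by omega)
  rw [Nat.odd_iff, Nat.odd_iff] at hodd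
  apply le_antisymm
  · rcases hodd with ho | ho
    · exact torus_upper h (by omega) ho
    · rw [max_comm]
      exact torus_upper h.swap (by omega) ho
  · rcases Nat.lt_or_ge 4 m with h1 | h1
    · refine max_le (torus_lower h h1 hn) ?_
      rcases Nat.lt_or_ge 4 n with h2 | h2
      · exact torus_lower h.swap h2 hm
      · obtain rfl : n = 4 := by omega
        refine le_trans ?_ (torus_lower h h1 hn)
        omega
    · obtain rfl : m = 4 := by omega
      refine max_le ?_ (torus_lower h.swap (by omega) hm)
      refine le_trans ?_ (torus_lower h.swap (by omega) hm)
      omega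

/-- For `m, n ≥ 4` with at least one of `m, n` odd,
`dmg(C_m □ C_n) = max {dmg(C_m)·n, dmg(C_n)·m} = max {⌊(m-1)/2⌋·n, ⌊(n-1)/2⌋·m}`. -/
theorem dmg_boxProd_cycles_odd {m n : ℕ} (hm : 4 ≤ m) (hn : 4 ≤ n)
    (hodd : Odd m ∨ Odd n) :
    dmg (cycleGraph m □ cycleGraph n) =
        max (dmg (cycleGraph m) * n) (dmg (cycleGraph n) * m) ∧
      dmg (cycleGraph m □ cycleGraph n) = max ((m - 1) / 2 * n) ((n - 1) / 2 * m) := by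
  have h := dmg_torus hm hn hodd
  refine ⟨?_, h⟩
  rw [h, dmg_cycle m hm, dmg_cycle n hn]
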